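/- There exist universal constants C₁, C₂, C₃ > 0 such that the following hypercontractive inequality holds. Let (X,Π) be a two-sided γ-local-spectral expander with γ ≤ k^{−C₁·i}, and let f ∈ C_k be an (ε,i)-pseudorandom function with lifted Bottom-Up level function f_i^↑. Then: E[(f_i^↑)⁴] ≤ C₂^i·ε·E[(f_i^↑)²]·‖f‖_∞² + k^{C₃·i}·ε·γ^{1/2}·‖D_i^k f‖₂²·‖f‖_∞². -/

import Mathlib

open Finset

/-- Functions on faces of a complex on vertex set `Fin n`. -/
abbrev Cf (n : ℕ) := Finset (Fin n) → ℝ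

/-- A `d`-dimensional weighted pure simplicial complex on vertex set `Fin n`:
the downward closure of a `d`-uniform hypergraph `faces d`, together with a
probability distribution on the top faces inducing distributions `w i` on each
level `faces i` via `π_i(x) = (1/(i+1))·Σ_{y ⊃ x} π_{i+1}(y)`. -/
structure WSC (n d : ℕ) where
  faces : ℕ → Finset (Finset (Fin n))
  top_nonempty : (faces d).Nonempty
  card_mem : ∀ i, ∀ s ∈ faces i, s.card = i
  empty_levels : ∀ i, d < i → faces i = ∅
  downward : ∀ i, i < d → ∀ s : Finset (Fin n),
    s ∈ faces i ↔ (s.card = i ∧ ∃ t ∈ faces (i+1), s ⊆ t)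
  w : ℕ → Finset (Fin n) → ℝ
  w_nonneg : ∀ i s, 0 ≤ w i s
  w_pos : ∀ i, ∀ s ∈ faces i, 0 < w i s
  w_zero : ∀ i s, s ∉ faces i → w i s = 0
  w_top_sum : ∑ s ∈ faces d, w d s = 1
  w_rec : ∀ i, i < d → ∀ s ∈ faces i,
    w i s = (1/(i+1 : ℝ)) * ∑ t ∈ (faces (i+1)).filter (fun t => s ⊆ t), w (i+1) t

variable {n d : ℕ}

/-- The up operator `U_k : C_k → C_{k+1}`. -/
noncomputable def Uop (X : WSC n d) (k : ℕ) (f : Cf n) : Cf n := fun τ =>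
  (1/(k+1 : ℝ)) * ∑ σ ∈ (X.faces k).filter (fun σ => σ ⊆ τ), f σ

/-- The down operator `D_{k+1} : C_{k+1} → C_k`. -/
noncomputable def Dop (X : WSC n d) (k : ℕ) (f : Cf n) : Cf n := fun τ =>
  (∑ σ ∈ (X.faces (k+1)).filter (fun σ => τ ⊆ σ), X.w (k+1) σ * f σ) /
  (∑ σ ∈ (X.faces (k+1)).filter (fun σ => τ ⊆ σ), X.w (k+1) σ)

/-- `Uc X i m : C_i → C_{i+m}` is the iterated up operator; `U_i^k = Uc X i (k-i)`. -/
noncomputable def Uc (X : WSC n d) (i : ℕ) : ℕ → Cf n → Cf n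
  | 0, f => f
  | m+1, f => Uop X (i+m) (Uc X i m f)

/-- `Dc X k m : C_k → C_{k-m}` is the iterated down operator; `D_i^k = Dc X k (k-i)`. -/
noncomputable def Dc (X : WSC n d) (k : ℕ) : ℕ → Cf n → Cf n
  | 0, f => f
  | m+1, f => Dop X (k - (m+1)) (Dc X k m f)

/-- Bottom-Up level functions: `g_i = D_i^k f − Σ_{j<i} C(i,j)·U_j^i g_j ∈ C_i`. -/
noncomputable def gLevel (X : WSC n d) (k : ℕ) (f : Cf n) : ℕ → Cf n
  | i => Dc X k (k - i) f - ∑ j ∈ (Finset.range i).attach,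
      ((i.choose j.1 : ℝ)) • Uc X j.1 (i - j.1) (gLevel X k f j.1)
  termination_by i => i
  decreasing_by exact Finset.mem_range.mp j.2

/-- Lifted Bottom-Up level functions: `f_i^↑ = C(k,i)·U_i^k g_i ∈ C_k`. -/
noncomputable def fLevel (X : WSC n d) (k : ℕ) (f : Cf n) (i : ℕ) : Cf n :=
  ((k.choose i : ℝ)) • Uc X i (k - i) (gLevel X k f i)

/-- Inner product at level `i`: `⟨f,g⟩ = E_{τ∼π_i}[f(τ)g(τ)]`. -/
noncomputable def ip (X : WSC n d) (i : ℕ) (f g : Cf n) : ℝ :=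
  ∑ τ ∈ X.faces i, X.w i τ * f τ * g τ

/-- Expectation at level `i`. -/
noncomputable def EE (X : WSC n d) (i : ℕ) (f : Cf n) : ℝ :=
  ∑ τ ∈ X.faces i, X.w i τ * f τ

/-- `L²` norm at level `i`. -/
noncomputable def norm2 (X : WSC n d) (i : ℕ) (f : Cf n) : ℝ := Real.sqrt (ip X i f f)

/-- `L^p` norm at level `i`. -/
noncomputable def normP (X : WSC n d) (i : ℕ) (p : ℝ) (f : Cf n) : ℝ :=
  (∑ τ ∈ X.faces i, X.w i τ * |f τ| ^ p) ^ (1/p)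

/-- `L^∞` norm at level `i` : the maximum of `|f|` over `i`-faces. -/
noncomputable def normInf (X : WSC n d) (i : ℕ) (f : Cf n) : ℝ :=
  ⨆ τ : {σ // σ ∈ X.faces i}, |f τ.1|

/-- `E_{X_τ}[f|_τ]`: the weighted mean of `f ∈ C_k` over `k`-faces containing `τ`. -/
noncomputable def linkMean (X : WSC n d) (k : ℕ) (τ : Finset (Fin n)) (f : Cf n) : ℝ :=
  (∑ ρ ∈ (X.faces k).filter (fun ρ => τ ⊆ ρ), X.w k ρ * f ρ) /
  (∑ ρ ∈ (X.faces k).filter (fun ρ => τ ⊆ ρ), X.w k ρ)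

/-- `⟨f|_τ, g|_τ⟩` over the link `X_τ` with its induced distribution, for `f, g ∈ C_k`. -/
noncomputable def linkIp (X : WSC n d) (k : ℕ) (τ : Finset (Fin n)) (f g : Cf n) : ℝ :=
  (∑ ρ ∈ (X.faces k).filter (fun ρ => τ ⊆ ρ), X.w k ρ * f ρ * g ρ) /
  (∑ ρ ∈ (X.faces k).filter (fun ρ => τ ⊆ ρ), X.w k ρ)

/-- `f ∈ C_k` is `(ε,i)`-pseudorandom: `|E_{X_τ}[f|_τ]| ≤ ε‖f‖_∞` and
`⟨f|_τ,f|_τ⟩ ≤ ε‖f‖_∞²` for every `i`-face `τ`. -/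
def Pseudorandom (X : WSC n d) (k : ℕ) (ε : ℝ) (i : ℕ) (f : Cf n) : Prop :=
  ∀ τ ∈ X.faces i, |linkMean X k τ f| ≤ ε * normInf X k f ∧
    linkIp X k τ f f ≤ ε * (normInf X k f)^2

/-- Boolean ({0,1}-valued) function on `X(k)`. -/
def IsBool (X : WSC n d) (k : ℕ) (f : Cf n) : Prop := ∀ τ ∈ X.faces k, f τ = 0 ∨ f τ = 1

/-- Total influence `I[f] = ⟨f, k(Id − U_{k−1}D_k) f⟩`. -/
noncomputable def influence (X : WSC n d) (k : ℕ) (f : Cf n) : ℝ :=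
  (k : ℝ) * (ip X k f f - ip X k f (Uop X (k-1) (Dop X (k-1) f)))

/-- Variance `Var(f) = E[f²] − E[f]²`. -/
noncomputable def variance (X : WSC n d) (k : ℕ) (f : Cf n) : ℝ :=
  ip X k f f - (EE X k f)^2

/-- The noise operator `T_ρ = Σ_{i=0}^k C(k,i)(1−ρ)^i ρ^{k−i} U_{k−i}^k D_{k−i}^k`. -/
noncomputable def noiseOp (X : WSC n d) (k : ℕ) (ρ : ℝ) (f : Cf n) : Cf n :=
  ∑ i ∈ Finset.range (k+1),
    ((k.choose i : ℝ) * (1-ρ)^i * ρ^(k-i)) • Uc X (k-i) i (Dc X k i f)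

/-- Noise stability `Stab_ρ(f) = ⟨f, T_ρ f⟩`. -/
noncomputable def stab (X : WSC n d) (k : ℕ) (ρ : ℝ) (f : Cf n) : ℝ :=
  ip X k f (noiseOp X k ρ f)

/-- Edge weights of the underlying graph of the link of `s ∈ X(i)`. -/
noncomputable def edgeW (X : WSC n d) (i : ℕ) (s : Finset (Fin n)) (u v : Fin n) : ℝ :=
  if u ≠ v ∧ u ∉ s ∧ v ∉ s ∧ insert u (insert v s) ∈ X.faces (i+2)
  then X.w (i+2) (insert u (insert v s)) else 0

/-- Vertex weights of the underlying graph of the link of `s ∈ X(i)`. -/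
noncomputable def vertW (X : WSC n d) (i : ℕ) (s : Finset (Fin n)) (u : Fin n) : ℝ :=
  ∑ v, edgeW X i s u v

/-- `X` is a two-sided `γ`-local-spectral expander: for every `i ≤ d−2` and every
`s ∈ X(i)` (including `s = ∅`), every nontrivial eigenvalue of the weighted adjacency
operator of the graph `(X_s(1), X_s(2))` has absolute value at most `γ`, expressed via
the quadratic form on functions orthogonal to constants. -/
def IsLSE (X : WSC n d) (γ : ℝ) : Prop :=
  ∀ i, i + 2 ≤ d → ∀ s ∈ X.faces i, ∀ f : Fin n → ℝ,
    (∑ u, vertW X i s u * f u) = 0 →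
    |∑ u, ∑ v, edgeW X i s u v * f u * f v| ≤ γ * ∑ u, vertW X i s u * (f u)^2

/-- The swap walk `S_{j,i} : C_i → C_j`: `(S_{j,i} f)(τ)` is the weighted mean of `f(σ)`
over `i`-faces `σ` disjoint from `τ` with `τ ∪ σ ∈ X(i+j)`. -/
noncomputable def swapW (X : WSC n d) (j i : ℕ) (f : Cf n) : Cf n := fun τ =>
  (∑ σ ∈ (X.faces i).filter (fun σ => Disjoint σ τ ∧ σ ∪ τ ∈ X.faces (i+j)),
      X.w (i+j) (σ ∪ τ) * f σ) /
  (∑ σ ∈ (X.faces i).filter (fun σ => Disjoint σ τ ∧ σ ∪ τ ∈ X.faces (i+j)),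
      X.w (i+j) (σ ∪ τ))

/-- Localized mean: `E_{σ ∼ π_{v,i}}[f(σ)]`, the mean of `f ∈ C_i` over the `i`-faces of
the link `X_v` of `v ∈ X(j)`, with respect to the distribution induced by the link. -/
noncomputable def locMean (X : WSC n d) (i j : ℕ) (v : Finset (Fin n)) (f : Cf n) : ℝ :=
  (∑ σ ∈ (X.faces i).filter (fun σ => Disjoint σ v ∧ σ ∪ v ∈ X.faces (i+j)),
      X.w (i+j) (σ ∪ v) * f σ) /
  (∑ σ ∈ (X.faces i).filter (fun σ => Disjoint σ v ∧ σ ∪ v ∈ X.faces (i+j)),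
      X.w (i+j) (σ ∪ v))

/-- The `m`-faces of the link `X_τ`. -/
noncomputable def lkFaces (X : WSC n d) (τ : Finset (Fin n)) (m : ℕ) : Finset (Finset (Fin n)) :=
  (Finset.univ : Finset (Finset (Fin n))).filter
    (fun σ => Disjoint σ τ ∧ σ ∪ τ ∈ X.faces (τ.card + m))

/-- Inner product at level `m` of the link `X_τ` (with the induced distribution). -/
noncomputable def lkIp (X : WSC n d) (τ : Finset (Fin n)) (m : ℕ) (f g : Cf n) : ℝ :=
  (∑ σ ∈ lkFaces X τ m, X.w (τ.card + m) (σ ∪ τ) * f σ * g σ) /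
  (∑ σ ∈ lkFaces X τ m, X.w (τ.card + m) (σ ∪ τ))

/-- `L²` norm at level `m` of the link `X_τ`. -/
noncomputable def lkNorm2 (X : WSC n d) (τ : Finset (Fin n)) (m : ℕ) (f : Cf n) : ℝ :=
  Real.sqrt (lkIp X τ m f f)

/-- Global mean at level `m` of the link `X_τ` (the stationary operator `U_0^j D_0^m`
of the swap walk on `X_τ` applied to `f`). -/
noncomputable def lkMeanLvl (X : WSC n d) (τ : Finset (Fin n)) (m : ℕ) (f : Cf n) : ℝ :=
  (∑ σ ∈ lkFaces X τ m, X.w (τ.card + m) (σ ∪ τ) * f σ) /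
  (∑ σ ∈ lkFaces X τ m, X.w (τ.card + m) (σ ∪ τ))

/-- The swap walk `S_{j,m}` within the link `X_τ`. -/
noncomputable def lkSwap (X : WSC n d) (τ : Finset (Fin n)) (j m : ℕ) (f : Cf n) : Cf n := fun v =>
  (∑ σ ∈ (lkFaces X τ m).filter (fun σ => Disjoint σ v ∧ σ ∪ v ∈ lkFaces X τ (m+j)),
      X.w (τ.card + m + j) (σ ∪ v ∪ τ) * f σ) /
  (∑ σ ∈ (lkFaces X τ m).filter (fun σ => Disjoint σ v ∧ σ ∪ v ∈ lkFaces X τ (m+j)),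
      X.w (τ.card + m + j) (σ ∪ v ∪ τ))

/-- Restriction `f|_τ(σ) = f(τ ∪ σ)`. -/
def restrictF (τ : Finset (Fin n)) (f : Cf n) : Cf n := fun σ => f (τ ∪ σ)

/-- The Bottom-Up level function of the restriction `f|_υ` computed within the link
`X_υ` (via its explicit form): `g_ℓ^{(υ)}(I) = Σ_{T ⊆ I} (−1)^{|I∖T|}·E_{(X_υ)_T}[f|_υ]`. -/
noncomputable def gLink (X : WSC n d) (k : ℕ) (f : Cf n) (υ : Finset (Fin n)) : Cf n :=
  fun I => ∑ σ ∈ I.powerset, (-1:ℝ)^((I \ σ).card) * linkMean X k (υ ∪ σ) f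

/-- A finite weighted space with coordinate functions indexed by `ι`. -/
structure CoordSpace (Ω ι V : Type*) where
  μ : Ω → ℝ
  pos : ∀ ω, 0 < μ ω
  x : Ω → ι → V

namespace CoordSpace

section Meas

variable {Ω ι V : Type*} (P : CoordSpace Ω ι V)

/-- `φ` depends only on the coordinates in `A`. -/
def Meas (A : Finset ι) (φ : Ω → ℝ) : Prop :=
  ∀ ω ω', (∀ a ∈ A, P.x ω' a = P.x ω a) → φ ω' = φ ω

variable {P}

lemma Meas.mono {A B : Finset ι} {φ : Ω → ℝ} (h : P.Meas A φ) (hAB : A ⊆ B) : P.Meas B φ :=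
  fun ω ω' H => h ω ω' fun a ha => H a (hAB ha)

lemma Meas.mul {A : Finset ι} {φ ψ : Ω → ℝ} (h : P.Meas A φ) (h' : P.Meas A ψ) :
    P.Meas A (φ * ψ) := fun ω ω' H => by simp [h ω ω' H, h' ω ω' H]

lemma Meas.abs {A : Finset ι} {φ : Ω → ℝ} (h : P.Meas A φ) :
    P.Meas A |φ| := fun ω ω' H => by simp [h ω ω' H]

lemma Meas.sub {A : Finset ι} {φ ψ : Ω → ℝ} (h : P.Meas A φ) (h' : P.Meas A ψ) :
    P.Meas A (φ - ψ) := fun ω ω' H => by simp [h ω ω' H, h' ω ω' H]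

lemma Meas.smul {A : Finset ι} {φ : Ω → ℝ} (c : ℝ) (h : P.Meas A φ) :
    P.Meas A (c • φ) := fun ω ω' H => by simp [h ω ω' H]

lemma Meas.sum {α : Type*} {A : Finset ι} {s : Finset α} {φ : α → Ω → ℝ}
    (h : ∀ i ∈ s, P.Meas A (φ i)) : P.Meas A (∑ i ∈ s, φ i) := fun ω ω' H => by
  simp only [Finset.sum_apply]
  exact sum_congr rfl fun i hi => h i hi ω ω' H

end Meas

section Basic

variable {Ω ι V : Type*} [Fintype Ω] (P : CoordSpace Ω ι V)

open Classical in
/-- The points agreeing with `ω` on the coordinates in `A`. -/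
noncomputable def cls (A : Finset ι) (ω : Ω) : Finset Ω :=
  univ.filter fun ω' => ∀ a ∈ A, P.x ω' a = P.x ω a

/-- Integration against the weight. -/
noncomputable def ex : (Ω → ℝ) →ₗ[ℝ] ℝ where
  toFun φ := ∑ ω, P.μ ω * φ ω
  map_add' φ ψ := by simp [mul_add, sum_add_distrib]
  map_smul' c φ := by
    simp only [Pi.smul_apply, smul_eq_mul, RingHom.id_apply, mul_sum]
    exact sum_congr rfl fun _ _ => by ring

/-- Conditional expectation given the coordinates in `A`. -/
noncomputable def ce (A : Finset ι) : (Ω → ℝ) →ₗ[ℝ] (Ω → ℝ) where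
  toFun φ ω := (∑ ω' ∈ P.cls A ω, P.μ ω' * φ ω') / ∑ ω' ∈ P.cls A ω, P.μ ω'
  map_add' φ ψ := by
    ext ω
    simp [mul_add, sum_add_distrib, add_div]
  map_smul' c φ := by
    ext ω
    simp only [Pi.smul_apply, smul_eq_mul, RingHom.id_apply, ← mul_div_assoc, mul_sum]
    congr 1
    exact sum_congr rfl fun _ _ => by ring

/-- The `L²` seminorm. -/
noncomputable def nrm (φ : Ω → ℝ) : ℝ := √(P.ex (φ * φ))

variable {P}

lemma mem_cls {A : Finset ι} {ω ω' : Ω} :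
    ω' ∈ P.cls A ω ↔ ∀ a ∈ A, P.x ω' a = P.x ω a := by
  simp [cls]

lemma mem_cls_comm {A : Finset ι} {ω ω' : Ω} : ω' ∈ P.cls A ω ↔ ω ∈ P.cls A ω' := by
  simp only [mem_cls, eq_comm]

lemma cls_eq {A : Finset ι} {ω ω' : Ω} (h : ω' ∈ P.cls A ω) : P.cls A ω' = P.cls A ω := by
  ext z
  rw [mem_cls] at h
  simp only [mem_cls]
  exact ⟨fun H a ha => (H a ha).trans (h a ha), fun H a ha => (H a ha).trans (h a ha).symm⟩

lemma mass_pos (A : Finset ι) (ω : Ω) : 0 < ∑ ω' ∈ P.cls A ω, P.μ ω' :=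
  sum_pos (fun _ _ => P.pos _) ⟨ω, mem_cls.2 fun _ _ => rfl⟩

lemma ex_apply (φ : Ω → ℝ) : P.ex φ = ∑ ω, P.μ ω * φ ω := rfl

lemma ce_apply (A : Finset ι) (φ : Ω → ℝ) (ω : Ω) :
    P.ce A φ ω = (∑ ω' ∈ P.cls A ω, P.μ ω' * φ ω') / ∑ ω' ∈ P.cls A ω, P.μ ω' := rfl

lemma ex_mono {φ ψ : Ω → ℝ} (h : ∀ ω, φ ω ≤ ψ ω) : P.ex φ ≤ P.ex ψ :=
  sum_le_sum fun ω _ => mul_le_mul_of_nonneg_left (h ω) (P.pos ω).le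

lemma ex_nonneg {φ : Ω → ℝ} (h : ∀ ω, 0 ≤ φ ω) : 0 ≤ P.ex φ :=
  sum_nonneg fun ω _ => mul_nonneg (P.pos ω).le (h ω)

lemma ce_mono {A : Finset ι} {φ ψ : Ω → ℝ} (h : ∀ ω, φ ω ≤ ψ ω) (ω : Ω) :
    P.ce A φ ω ≤ P.ce A ψ ω :=
  div_le_div_of_nonneg_right
    (sum_le_sum fun ω _ => mul_le_mul_of_nonneg_left (h ω) (P.pos ω).le) (mass_pos A ω).le

lemma ce_nonneg {A : Finset ι} {φ : Ω → ℝ} (h : ∀ ω, 0 ≤ φ ω) (ω : Ω) : 0 ≤ P.ce A φ ω :=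
  div_nonneg (sum_nonneg fun ω _ => mul_nonneg (P.pos ω).le (h ω)) (mass_pos A ω).le

lemma ce_le {A : Finset ι} {φ : Ω → ℝ} {c : ℝ} (h : ∀ ω, φ ω ≤ c) (ω : Ω) : P.ce A φ ω ≤ c := by
  rw [ce_apply, div_le_iff₀ (mass_pos A ω), mul_sum]
  refine sum_le_sum fun ω _ => ?_
  rw [mul_comm]
  exact mul_le_mul_of_nonneg_right (h ω) (P.pos ω).le

lemma le_ce {A : Finset ι} {φ : Ω → ℝ} {c : ℝ} (h : ∀ ω, c ≤ φ ω) (ω : Ω) : c ≤ P.ce A φ ω := by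
  rw [ce_apply, le_div_iff₀ (mass_pos A ω), mul_sum]
  refine sum_le_sum fun ω _ => ?_
  rw [mul_comm]
  exact mul_le_mul_of_nonneg_left (h ω) (P.pos ω).le

lemma abs_ce_le {A : Finset ι} {φ : Ω → ℝ} {c : ℝ} (h : ∀ ω, |φ ω| ≤ c) (ω : Ω) :
    |P.ce A φ ω| ≤ c :=
  abs_le.2 ⟨le_ce (fun ω => (abs_le.1 (h ω)).1) ω, ce_le (fun ω => (abs_le.1 (h ω)).2) ω⟩

lemma meas_ce (A : Finset ι) (φ : Ω → ℝ) : P.Meas A (P.ce A φ) := by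
  intro ω ω' h
  rw [ce_apply, ce_apply, cls_eq (mem_cls.2 h)]

lemma ce_mul {A : Finset ι} {ψ : Ω → ℝ} (hψ : P.Meas A ψ) (φ : Ω → ℝ) :
    P.ce A (ψ * φ) = ψ * P.ce A φ := by
  ext ω
  simp only [ce_apply, Pi.mul_apply, ← mul_div_assoc, mul_sum]
  congr 1
  refine sum_congr rfl fun ω' h => ?_
  rw [hψ ω ω' (mem_cls.1 h)]
  ring

lemma ce_eq_self {A : Finset ι} {ψ : Ω → ℝ} (hψ : P.Meas A ψ) : P.ce A ψ = ψ := by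
  have h := ce_mul hψ 1
  rw [mul_one] at h
  rw [h]
  ext ω
  simp [ce_apply, (mass_pos A ω).ne']

lemma ex_ce (A : Finset ι) (φ : Ω → ℝ) : P.ex (P.ce A φ) = P.ex φ := by
  classical
  simp only [ex_apply, ce_apply, sum_div, mul_sum]
  rw [sum_comm' (s' := fun ω => P.cls A ω) (t' := univ)]
  · refine sum_congr rfl fun ω _ => ?_
    have : ∀ ω' ∈ P.cls A ω, P.μ ω' * (P.μ ω * φ ω / ∑ z ∈ P.cls A ω', P.μ z)
        = P.μ ω' * (P.μ ω * φ ω / ∑ z ∈ P.cls A ω, P.μ z) := fun ω' h => by rw [cls_eq h]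
    rw [sum_congr rfl this, ← sum_mul]
    field_simp [(mass_pos (P := P) A ω).ne']
  · intro ω ω'
    simp [mem_cls_comm]

lemma ex_mul_ce {A : Finset ι} {ψ : Ω → ℝ} (hψ : P.Meas A ψ) (φ : Ω → ℝ) :
    P.ex (ψ * P.ce A φ) = P.ex (ψ * φ) := by
  rw [← ce_mul hψ, ex_ce]

lemma ce_ce_of_subset {C A : Finset ι} (h : C ⊆ A) (φ : Ω → ℝ) :
    P.ce C (P.ce A φ) = P.ce C φ := by
  classical
  ext ω
  have key : ∀ θ : Ω → ℝ, ∑ z ∈ P.cls C ω, P.μ z * θ z =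
      P.ex ((fun z => if z ∈ P.cls C ω then 1 else 0) * θ) := by
    intro θ
    simp [ex_apply, mul_ite, sum_ite_mem]
  rw [ce_apply, ce_apply, key, key, ex_mul_ce]
  intro z z' hz
  have : z' ∈ P.cls C z := mem_cls.2 fun a ha => hz a (h ha)
  have h2 : z' ∈ P.cls C ω ↔ z ∈ P.cls C ω := by
    rw [mem_cls_comm, cls_eq this, mem_cls_comm]
  simp [h2]

lemma ex_mul_self_nonneg (φ : Ω → ℝ) : 0 ≤ P.ex (φ * φ) :=
  ex_nonneg fun _ => mul_self_nonneg _

lemma nrm_nonneg (φ : Ω → ℝ) : 0 ≤ P.nrm φ := Real.sqrt_nonneg _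

lemma nrm_sq (φ : Ω → ℝ) : P.nrm φ ^ 2 = P.ex (φ * φ) := Real.sq_sqrt (ex_mul_self_nonneg φ)

lemma abs_ex_mul_le (φ ψ : Ω → ℝ) : |P.ex (φ * ψ)| ≤ P.nrm φ * P.nrm ψ := by
  rw [nrm, nrm, ← Real.sqrt_mul (ex_mul_self_nonneg φ)]
  refine Real.abs_le_sqrt ?_
  have := sum_sq_le_sum_mul_sum_of_sq_le_mul univ (r := fun ω => P.μ ω * (φ ω * ψ ω))
    (f := fun ω => P.μ ω * (φ ω * φ ω)) (g := fun ω => P.μ ω * (ψ ω * ψ ω))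
    (fun ω _ => mul_nonneg (P.pos ω).le (mul_self_nonneg _))
    (fun ω _ => mul_nonneg (P.pos ω).le (mul_self_nonneg _)) (fun ω _ => by apply le_of_eq; ring)
  exact this

lemma nrm_le {φ : Ω → ℝ} {c : ℝ} (hc : 0 ≤ c) (h : P.ex (φ * φ) ≤ c ^ 2) : P.nrm φ ≤ c :=
  Real.sqrt_le_iff.2 ⟨hc, h⟩

lemma nrm_add_le (φ ψ : Ω → ℝ) : P.nrm (φ + ψ) ≤ P.nrm φ + P.nrm ψ := by
  refine nrm_le (add_nonneg (nrm_nonneg _) (nrm_nonneg _)) ?_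
  have h := (abs_le.1 (abs_ex_mul_le (P := P) φ ψ)).2
  have e : (φ + ψ) * (φ + ψ) = φ * φ + (2 : ℝ) • (φ * ψ) + ψ * ψ := by
    ext ω; simp; ring
  rw [e, map_add, map_add, map_smul, ← nrm_sq, ← nrm_sq, smul_eq_mul]
  nlinarith

lemma nrm_smul (c : ℝ) (φ : Ω → ℝ) : P.nrm (c • φ) = |c| * P.nrm φ := by
  rw [nrm, nrm, ← Real.sqrt_sq_eq_abs, ← Real.sqrt_mul (sq_nonneg c)]
  congr 1
  rw [smul_mul_smul_comm, map_smul, smul_eq_mul, sq]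

lemma nrm_zero : P.nrm 0 = 0 := by simp [nrm]

lemma nrm_sum_le {α : Type*} (s : Finset α) (φ : α → Ω → ℝ) :
    P.nrm (∑ i ∈ s, φ i) ≤ ∑ i ∈ s, P.nrm (φ i) := by
  classical
  induction s using Finset.induction_on with
  | empty => simp [nrm_zero]
  | insert a s ha ih =>
    rw [sum_insert ha, sum_insert ha]
    exact (nrm_add_le _ _).trans (by gcongr)

lemma nrm_mul_le {φ : Ω → ℝ} {c : ℝ} (hc : 0 ≤ c) (h : ∀ ω, |φ ω| ≤ c) (ψ : Ω → ℝ) :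
    P.nrm (φ * ψ) ≤ c * P.nrm ψ := by
  refine nrm_le (mul_nonneg hc (nrm_nonneg _)) ?_
  rw [mul_pow, nrm_sq, ← smul_eq_mul (c ^ 2), ← map_smul]
  refine ex_mono fun ω => ?_
  have := sq_le_sq' (abs_le.1 (h ω)).1 (abs_le.1 (h ω)).2
  simp only [Pi.mul_apply, Pi.smul_apply, smul_eq_mul]
  nlinarith [mul_le_mul_of_nonneg_right this (mul_self_nonneg (ψ ω))]

lemma nrm_abs (φ : Ω → ℝ) : P.nrm |φ| = P.nrm φ := by
  have : |φ| * |φ| = φ * φ := by ext ω; simp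
  rw [nrm, nrm, this]

lemma nrm_ce_le (A : Finset ι) (φ : Ω → ℝ) : P.nrm (P.ce A φ) ≤ P.nrm φ := by
  have h := (abs_le.1 (abs_ex_mul_le (P := P) (P.ce A φ) φ)).2
  rw [← ex_mul_ce (meas_ce A φ), ← nrm_sq] at h
  rcases (nrm_nonneg (P := P) (P.ce A φ)).eq_or_lt with h0 | h0
  · rw [← h0]; exact nrm_nonneg _
  · nlinarith

/-- Conditional Cauchy–Schwarz for finite families. -/
lemma sq_sum_ce_le {α : Type*} (s : Finset α) (A : Finset ι) (φ ψ : α → Ω → ℝ) (ω : Ω) :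
    (∑ j ∈ s, P.ce A |φ j * ψ j| ω) ^ 2 ≤
      (∑ j ∈ s, P.ce A (φ j * φ j) ω) * ∑ j ∈ s, P.ce A (ψ j * ψ j) ω := by
  refine sum_sq_le_sum_mul_sum_of_sq_le_mul s (fun j _ => ce_nonneg (fun _ => mul_self_nonneg _) ω)
    (fun j _ => ce_nonneg (fun _ => mul_self_nonneg _) ω) fun j _ => ?_
  simp only [ce_apply]
  rw [div_pow, div_mul_div_comm, ← sq (∑ ω' ∈ P.cls A ω, P.μ ω')]
  refine div_le_div_of_nonneg_right (sum_sq_le_sum_mul_sum_of_sq_le_mul _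
    (fun ω _ => mul_nonneg (P.pos ω).le (mul_self_nonneg _))
    (fun ω _ => mul_nonneg (P.pos ω).le (mul_self_nonneg _)) (fun ω _ => ?_)) (sq_nonneg _)
  simp only [Pi.abs_apply, Pi.mul_apply, mul_pow, sq_abs]
  apply le_of_eq
  ring

end Basic

end CoordSpace

namespace CoordSpace

section NearIndep

variable {Ω ι V : Type*} [Fintype Ω] {P : CoordSpace Ω ι V}

/-- One induction step for near independence: reveal a larger set of coordinates first. -/
lemma near_indep_step {C C' : Finset ι} (hC : C ⊆ C') {φ ψ : Ω → ℝ} {c c' : ℝ}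
    (hc' : 0 ≤ c')
    (h1 : |P.ex (φ * ψ) - P.ex (P.ce C' φ * P.ce C' ψ)| ≤ c * P.nrm φ * P.nrm ψ)
    (h2 : |P.ex (P.ce C' φ * ψ) - P.ex (P.ce C (P.ce C' φ) * P.ce C ψ)| ≤
      c' * P.nrm (P.ce C' φ) * P.nrm ψ) :
    |P.ex (φ * ψ) - P.ex (P.ce C φ * P.ce C ψ)| ≤ (c + c') * P.nrm φ * P.nrm ψ := by
  rw [ex_mul_ce (meas_ce _ _)] at h1
  rw [ce_ce_of_subset hC] at h2
  have h3 : c' * P.nrm (P.ce C' φ) * P.nrm ψ ≤ c' * P.nrm φ * P.nrm ψ := by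
    gcongr
    exacts [nrm_nonneg _, nrm_ce_le _ _]
  have := abs_sub_le (P.ex (φ * ψ)) (P.ex (P.ce C' φ * ψ)) (P.ex (P.ce C φ * P.ce C ψ))
  linarith

lemma near_indep_of_meas {C : Finset ι} {φ ψ : Ω → ℝ} (hφ : P.Meas C φ) :
    P.ex (φ * ψ) - P.ex (P.ce C φ * P.ce C ψ) = 0 := by
  rw [ce_eq_self hφ, ex_mul_ce hφ, sub_self]

end NearIndep

section Swap

variable {Ω ι V : Type*} [Fintype Ω] [DecidableEq ι] (P : CoordSpace Ω ι V)

/-- Any two coordinates are `γ`-close to independent after conditioning on further coordinates. -/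
def IsProd (γ : ℝ) : Prop :=
  ∀ (C : Finset ι) (a b : ι), a ∉ C → b ∉ C → a ≠ b → ∀ φ ψ : Ω → ℝ,
    P.Meas (insert a C) φ → P.Meas (insert b C) ψ →
    |P.ex (φ * ψ) - P.ex (P.ce C φ * P.ce C ψ)| ≤ γ * P.nrm φ * P.nrm ψ

/-- The Efron–Stein type component of `f` on the coordinates `S` after fixing those in `R`. -/
noncomputable def lev (f : Ω → ℝ) (R S : Finset ι) : Ω → ℝ :=
  ∑ T ∈ S.powerset, (-1 : ℝ) ^ (S \ T).card • P.ce (R ∪ T) f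

variable {P} {γ : ℝ}

lemma IsProd.near_indep_singleton (hP : P.IsProd γ) (hγ : 0 ≤ γ) (B : Finset ι) :
    ∀ (C : Finset ι) (a : ι), a ∉ C → a ∉ B → Disjoint B C → ∀ φ ψ : Ω → ℝ,
    P.Meas (B ∪ C) φ → P.Meas (insert a C) ψ →
    |P.ex (φ * ψ) - P.ex (P.ce C φ * P.ce C ψ)| ≤ B.card * γ * P.nrm φ * P.nrm ψ := by
  induction B using Finset.induction_on with
  | empty =>
    intro C a _ _ _ φ ψ hφ _
    rw [empty_union] at hφ
    simp [near_indep_of_meas hφ]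
  | insert b B hb ih =>
    intro C a haC haB hBC φ ψ hφ hψ
    rw [disjoint_insert_left] at hBC
    rw [mem_insert, not_or] at haB
    rw [card_insert_of_notMem hb, Nat.cast_succ, add_mul, one_mul]
    refine near_indep_step (C' := insert b C) (subset_insert _ _) hγ ?_ ?_
    · refine ih (insert b C) a ?_ haB.2 ?_ φ ψ (hφ.mono ?_) (hψ.mono ?_)
      · simp [haB.1, haC]
      · simp [hb, hBC.2]
      · intro z; simp
      · intro z; simp only [mem_insert]; tauto
    · exact hP C b a hBC.1 haC (Ne.symm haB.1) _ _ (meas_ce _ _) hψ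

lemma IsProd.near_indep_disjoint (hP : P.IsProd γ) (hγ : 0 ≤ γ) (B A : Finset ι) :
    ∀ C : Finset ι, Disjoint A B → Disjoint A C → Disjoint B C → ∀ φ ψ : Ω → ℝ,
    P.Meas (A ∪ C) φ → P.Meas (B ∪ C) ψ →
    |P.ex (φ * ψ) - P.ex (P.ce C φ * P.ce C ψ)| ≤ A.card * B.card * γ * P.nrm φ * P.nrm ψ := by
  induction A using Finset.induction_on with
  | empty =>
    intro C _ _ _ φ ψ hφ _
    rw [empty_union] at hφ
    simp [near_indep_of_meas hφ]
  | insert a A ha ih =>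
    intro C hAB hAC hBC φ ψ hφ hψ
    rw [disjoint_insert_left] at hAB hAC
    rw [card_insert_of_notMem ha, Nat.cast_succ, add_mul, add_mul, one_mul]
    refine near_indep_step (C' := insert a C) (subset_insert _ _) (by positivity) ?_ ?_
    · refine ih (insert a C) hAB.2 ?_ ?_ φ ψ (hφ.mono ?_) (hψ.mono ?_)
      · simp [ha, hAC.2]
      · simp [hAB.1, hBC]
      · intro z; simp
      · intro z; simp only [mem_union, mem_insert]; tauto
    · have := hP.near_indep_singleton hγ B C a hAC.1 hAB.1 hBC ψ (P.ce (insert a C) φ) hψ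
        (meas_ce _ _)
      rw [mul_comm ψ, mul_comm (P.ce C ψ)] at this
      refine this.trans (le_of_eq ?_)
      ring

lemma meas_lev (f : Ω → ℝ) (R S : Finset ι) : P.Meas (R ∪ S) (P.lev f R S) :=
  Meas.sum fun _ hT => ((meas_ce _ _).mono (union_subset_union_right (mem_powerset.1 hT))).smul _

lemma lev_eq_sum_erase {f : Ω → ℝ} {R S : Finset ι} {v : ι} (hv : v ∈ S) :
    P.lev f R S = ∑ T ∈ (S.erase v).powerset, (-1 : ℝ) ^ ((S.erase v) \ T).card •
      (P.ce (R ∪ insert v T) f - P.ce (R ∪ T) f) := by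
  conv_lhs => rw [← insert_erase hv]
  rw [lev, sum_powerset_insert (notMem_erase v S), ← sum_add_distrib]
  refine sum_congr rfl fun T hT => ?_
  have hvT : v ∉ T := fun h => notMem_erase v S (mem_powerset.1 hT h)
  have e1 : insert v (S.erase v) \ insert v T = S.erase v \ T := by
    ext z; simp only [mem_sdiff, mem_insert, mem_erase]; by_cases z = v <;> simp_all
  have e2 : insert v (S.erase v) \ T = insert v (S.erase v \ T) := by
    rw [insert_sdiff_of_notMem _ hvT]
  rw [e1, e2, card_insert_of_notMem (by simp), pow_succ, smul_sub, mul_neg_one, neg_smul]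
  abel

variable [Fintype ι]

/-- Functions of two coordinate sets meeting inside `C` are nearly independent given `C`. -/
lemma IsProd.near_indep (hP : P.IsProd γ) (hγ : 0 ≤ γ) {G H C : Finset ι} (hC : G ∩ H ⊆ C)
    {φ ψ : Ω → ℝ} (hφ : P.Meas G φ) (hψ : P.Meas H ψ) :
    |P.ex (φ * ψ) - P.ex (P.ce C φ * P.ce C ψ)| ≤
      (Fintype.card ι : ℝ) ^ 2 * γ * P.nrm φ * P.nrm ψ := by
  have hd : Disjoint (G \ C) (H \ C) := by
    rw [disjoint_left]
    intro z hz hz'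
    rw [mem_sdiff] at hz hz'
    exact hz.2 (hC (mem_inter.2 ⟨hz.1, hz'.1⟩))
  refine (hP.near_indep_disjoint hγ (H \ C) (G \ C) C hd sdiff_disjoint sdiff_disjoint φ ψ
    (hφ.mono (by simp)) (hψ.mono (by simp))).trans ?_
  have h1 : ((G \ C).card : ℝ) ≤ Fintype.card ι := by exact_mod_cast card_le_univ _
  have h2 : ((H \ C).card : ℝ) ≤ Fintype.card ι := by exact_mod_cast card_le_univ _
  rw [sq]
  gcongr
  exacts [nrm_nonneg _, nrm_nonneg _]

lemma IsProd.nrm_ce_sub_ce_le (hP : P.IsProd γ) (hγ : 0 ≤ γ) {G H C : Finset ι} (hCG : C ⊆ G)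
    (hC : G ∩ H ⊆ C) {ψ : Ω → ℝ} (hψ : P.Meas H ψ) :
    P.nrm (P.ce G ψ - P.ce C ψ) ≤ (Fintype.card ι : ℝ) ^ 2 * γ * P.nrm ψ := by
  set a := P.ce G ψ - P.ce C ψ with ha
  have hm : P.Meas G a := (meas_ce _ _).sub ((meas_ce _ _).mono hCG)
  have h0 : P.ce C a = 0 := by
    rw [ha, map_sub, ce_ce_of_subset hCG, ce_eq_self (meas_ce C ψ), sub_self]
  have h := hP.near_indep hγ hC hm hψ
  have h1 : P.ex (a * ψ) = P.nrm a ^ 2 := by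
    have e : P.ex (a * P.ce C ψ) = 0 := by
      rw [mul_comm, ← ex_mul_ce (meas_ce _ _), h0, mul_zero, map_zero]
    rw [nrm_sq, ← ex_mul_ce hm, ← sub_zero (P.ex (a * P.ce G ψ)), ← e, ← map_sub, ← mul_sub]
  rw [h0, zero_mul, map_zero, sub_zero, h1, abs_of_nonneg (sq_nonneg _)] at h
  rcases (nrm_nonneg (P := P) a).eq_or_lt with h2 | h2
  · rw [← h2]
    have := nrm_nonneg (P := P) ψ
    positivity
  · nlinarith

end Swap

section Level

variable {Ω ι V : Type*} [Fintype Ω] [DecidableEq ι] [Fintype ι] (P : CoordSpace Ω ι V)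

/-- The hypotheses on `f` and on the size parameters under which the fourth moment of the
`i`-th level of `f` is controlled. -/
structure Regular (f : Ω → ℝ) (i : ℕ) (γ B M D E : ℝ) : Prop where
  prod : P.IsProd γ
  γ0 : 0 ≤ γ
  B0 : 0 ≤ B
  M0 : 0 ≤ M
  D0 : 0 ≤ D
  bound : ∀ T : Finset ι, T.card ≤ i → ∀ ω, |P.ce T f ω| ≤ B
  var : ∀ T : Finset ι, T.card ≤ i → ∀ ω, P.ce T (f * f) ω ≤ M
  l2 : ∀ T : Finset ι, T.card ≤ i → P.nrm (P.ce T f) ≤ D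
  two_pow : (2 : ℝ) ^ i ≤ E
  two_le : 2 ≤ E
  card_sq : (Fintype.card ι : ℝ) ^ 2 ≤ E ^ 2
  card_sets : ((powersetCard i (univ : Finset ι)).card : ℝ) ≤ E

variable {P} {f : Ω → ℝ} {i : ℕ} {γ B M D E : ℝ}

namespace Regular

lemma E0 (h : P.Regular f i γ B M D E) : 0 ≤ E := by linarith [h.two_le]

lemma one_le (h : P.Regular f i γ B M D E) : 1 ≤ E := by linarith [h.two_le]

lemma card_powerset_le (h : P.Regular f i γ B M D E)
    {S : Finset ι} (hS : S.card ≤ i) : (S.powerset.card : ℝ) ≤ E := by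
  refine le_trans ?_ h.two_pow
  rw [card_powerset]
  exact_mod_cast Nat.pow_le_pow_right (by norm_num) hS

lemma abs_lev_le (h : P.Regular f i γ B M D E)
    {R S : Finset ι} (hRS : R.card + S.card ≤ i) (ω : Ω) :
    |P.lev f R S ω| ≤ E * B := by
  rw [lev, Finset.sum_apply]
  refine (abs_sum_le_sum_abs _ _).trans ((sum_le_card_nsmul _ _ B fun T hT => ?_).trans ?_)
  · simp only [Pi.smul_apply, smul_eq_mul, abs_mul, abs_pow, abs_neg, abs_one, one_pow, one_mul]
    refine h.bound _ ?_ ω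
    have := card_le_card (mem_powerset.1 hT)
    have := card_union_le R T
    omega
  · rw [nsmul_eq_mul]
    exact mul_le_mul_of_nonneg_right
      (h.card_powerset_le (by omega)) h.B0

lemma nrm_lev_le (h : P.Regular f i γ B M D E)
    {R S : Finset ι} (hRS : R.card + S.card ≤ i) : P.nrm (P.lev f R S) ≤ E * D := by
  rw [lev]
  refine (nrm_sum_le _ _).trans ((sum_le_card_nsmul _ _ D fun T hT => ?_).trans ?_)
  · simp only [nrm_smul, abs_pow, abs_neg, abs_one, one_pow, one_mul]
    refine h.l2 _ ?_
    have := card_le_card (mem_powerset.1 hT)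
    have := card_union_le R T
    omega
  · rw [nsmul_eq_mul]
    exact mul_le_mul_of_nonneg_right
      (h.card_powerset_le (by omega)) h.D0

lemma near_indep (h : P.Regular f i γ B M D E) {G H C : Finset ι} (hC : G ∩ H ⊆ C)
    {φ ψ : Ω → ℝ} (hφ : P.Meas G φ) (hψ : P.Meas H ψ) :
    |P.ex (φ * ψ) - P.ex (P.ce C φ * P.ce C ψ)| ≤ E ^ 2 * γ * P.nrm φ * P.nrm ψ := by
  refine (h.prod.near_indep h.γ0 hC hφ hψ).trans ?_
  have := h.card_sq
  have := h.γ0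
  gcongr
  exacts [nrm_nonneg _, nrm_nonneg _]

lemma nrm_ce_sub_ce_le (h : P.Regular f i γ B M D E) {G H C : Finset ι} (hCG : C ⊆ G)
    (hC : G ∩ H ⊆ C) {ψ : Ω → ℝ} (hψ : P.Meas H ψ) :
    P.nrm (P.ce G ψ - P.ce C ψ) ≤ E ^ 2 * γ * P.nrm ψ := by
  refine (h.prod.nrm_ce_sub_ce_le h.γ0 hCG hC hψ).trans ?_
  have := h.card_sq
  have := h.γ0
  gcongr
  exact nrm_nonneg _

lemma nrm_ce_lev_le (h : P.Regular f i γ B M D E)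
    {R S : Finset ι} {v : ι} (hRS : R.card + S.card ≤ i) (hv : v ∈ S)
    (hvR : v ∉ R) : P.nrm (P.ce (R ∪ S.erase v) (P.lev f R S)) ≤ E ^ 3 * γ * D := by
  have hS := card_erase_add_one hv
  have hγ := h.γ0
  have hD := h.D0
  rw [lev_eq_sum_erase hv, map_sum]
  refine (nrm_sum_le _ _).trans
    ((sum_le_card_nsmul _ _ (E ^ 2 * γ * D) fun T hT => ?_).trans ?_)
  · have hT' := mem_powerset.1 hT
    have := card_le_card hT'
    simp only [map_smul, nrm_smul, abs_pow, abs_neg, abs_one, one_pow, one_mul, map_sub]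
    have e : P.ce (R ∪ S.erase v) (P.ce (R ∪ T) f)
        = P.ce (R ∪ T) (P.ce (R ∪ insert v T) f) := by
      rw [ce_ce_of_subset (union_subset_union_right (subset_insert _ _)),
        ce_eq_self ((meas_ce _ _).mono (union_subset_union_right hT'))]
    rw [e]
    refine (h.nrm_ce_sub_ce_le (H := R ∪ insert v T) (union_subset_union_right hT') ?_
      (meas_ce _ _)).trans ?_
    · intro z
      simp only [mem_inter, mem_union, mem_insert, mem_erase]
      rintro ⟨h1, h2⟩
      by_cases hz : z = v
      · subst hz; simp_all
      · tauto
    · gcongr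
      refine h.l2 _ ?_
      have := card_union_le R (insert v T)
      have := card_insert_le v T
      omega
  · rw [nsmul_eq_mul]
    have := h.card_powerset_le (S := S.erase v) (by omega)
    calc _ ≤ E * (E ^ 2 * γ * D) := by gcongr
      _ = _ := by ring

/-- A level function is nearly orthogonal to functions not depending on one of its coordinates. -/
lemma abs_ex_mul_lev_le (h : P.Regular f i γ B M D E)
    {R S G : Finset ι} {v : ι} (hRS : R.card + S.card ≤ i) (hv : v ∈ S)
    (hvR : v ∉ R) (hvG : v ∉ G) {a : Ω → ℝ} (ha : P.Meas G a) :
    |P.ex (a * P.lev f R S)| ≤ E ^ 4 * γ * P.nrm a * D := by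
  have hγ := h.γ0
  have hD := h.D0
  have hE := h.E0
  have ha0 := nrm_nonneg (P := P) a
  set C := R ∪ S.erase v
  have h1 := h.near_indep (C := C) (G := G) (H := R ∪ S) (by
    intro z
    simp only [C, mem_inter, mem_union, mem_erase]
    rintro ⟨h1, h2⟩
    have : z ≠ v := by rintro rfl; exact hvG h1
    tauto) ha (meas_lev f R S)
  have h2 : |P.ex (P.ce C a * P.ce C (P.lev f R S))| ≤ P.nrm a * (E ^ 3 * γ * D) :=
    (abs_ex_mul_le _ _).trans (mul_le_mul (nrm_ce_le _ _) (h.nrm_ce_lev_le hRS hv hvR)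
      (nrm_nonneg _) ha0)
  have h3 : E ^ 2 * γ * P.nrm a * P.nrm (P.lev f R S) ≤ E ^ 2 * γ * P.nrm a * (E * D) := by
    gcongr
    exact h.nrm_lev_le hRS
  have h4 : 2 * (E ^ 3 * γ * P.nrm a * D) ≤ E * (E ^ 3 * γ * P.nrm a * D) := by
    gcongr
    exact h.two_le
  have := abs_sub_abs_le_abs_sub (P.ex (a * P.lev f R S))
    (P.ex (P.ce C a * P.ce C (P.lev f R S)))
  linarith

end Regular

end Level

end CoordSpace

namespace CoordSpace

section FourthMoment

variable {Ω ι V : Type*} [Fintype Ω] [DecidableEq ι] {P : CoordSpace Ω ι V} {f : Ω → ℝ}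

lemma lev_eq_sum_lev_sdiff {K S : Finset ι} (hKS : K ⊆ S) :
    P.lev f ∅ S = ∑ R ∈ K.powerset, (-1 : ℝ) ^ (K \ R).card • P.lev f R (S \ K) := by
  simp only [lev, smul_sum, smul_smul]
  rw [← sum_product']
  symm
  refine sum_nbij' (fun x => x.1 ∪ x.2) (fun T => (T ∩ K, T \ K)) ?_ ?_ ?_ ?_ ?_
  · rintro ⟨R, T⟩ hx
    simp only [mem_product, mem_powerset] at hx ⊢
    exact union_subset (hx.1.trans hKS) (hx.2.trans sdiff_subset)
  · intro T hT
    simp only [mem_product, mem_powerset] at hT ⊢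
    exact ⟨inter_subset_right, sdiff_subset_sdiff hT (Subset.refl _)⟩
  · rintro ⟨R, T⟩ hx
    simp only [mem_product, mem_powerset] at hx
    have hT : ∀ z ∈ T, z ∉ K := fun z hz => (mem_sdiff.1 (hx.2 hz)).2
    refine Prod.ext ?_ ?_
    · ext z
      simp only [mem_inter, mem_union]
      have := hT z
      have := @hx.1 z
      tauto
    · ext z
      simp only [mem_sdiff, mem_union]
      have := hT z
      have := @hx.1 z
      tauto
  · intro T _
    ext z
    simp only [mem_union, mem_inter, mem_sdiff]
    tauto
  · rintro ⟨R, T⟩ hx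
    simp only [mem_product, mem_powerset] at hx
    have e : S \ (R ∪ T) = (K \ R) ∪ ((S \ K) \ T) := by
      ext z
      simp only [mem_sdiff, mem_union]
      have := @hx.1 z
      have h2 := @hx.2 z
      have := @hKS z
      simp only [mem_sdiff] at h2
      tauto
    have hd : Disjoint (K \ R) ((S \ K) \ T) := by
      rw [disjoint_left]
      intro z hz hz'
      simp only [mem_sdiff] at hz hz'
      exact hz'.1.2 hz.1
    simp only [empty_union]
    rw [e, card_union_of_disjoint hd, pow_add]

variable {i : ℕ} {γ B M D E : ℝ}

lemma sq_lev_le {K S : Finset ι} (hKS : K ⊆ S) (hK : K.card ≤ i) (ω : Ω) :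
    (P.lev f ∅ S * P.lev f ∅ S) ω ≤
      2 ^ i * ∑ R ∈ K.powerset, (P.lev f R (S \ K) * P.lev f R (S \ K)) ω := by
  rw [lev_eq_sum_lev_sdiff hKS]
  simp only [Pi.mul_apply, Finset.sum_apply, ← sq]
  refine (sq_sum_le_card_mul_sum_sq).trans ?_
  rw [card_powerset]
  have e : ∀ R, ((-1 : ℝ) ^ (K \ R).card • P.lev f R (S \ K)) ω ^ 2 = P.lev f R (S \ K) ω ^ 2 := by
    intro R
    rw [Pi.smul_apply, smul_eq_mul, mul_pow, ← pow_mul, mul_comm _ 2, pow_mul]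
    simp
  simp only [e]
  refine mul_le_mul_of_nonneg_right ?_ (sum_nonneg fun _ _ => sq_nonneg _)
  exact_mod_cast Nat.pow_le_pow_right (by norm_num) hK

variable [Fintype ι]

variable (P f i) in
/-- The total squared `i`-th level mass above `K`, conditioned on the coordinates in `K`. -/
noncomputable def massAbove (K : Finset ι) : Ω → ℝ :=
  ∑ S ∈ powersetCard i univ with K ⊆ S, P.ce K (P.lev f ∅ S * P.lev f ∅ S)

variable (P f i) in
/-- The `i`-th level of `f`. -/
noncomputable def level : Ω → ℝ := ∑ S ∈ powersetCard i univ, P.lev f ∅ S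

lemma massAbove_nonneg (K : Finset ι) (ω : Ω) : 0 ≤ P.massAbove f i K ω := by
  rw [massAbove, Finset.sum_apply]
  exact sum_nonneg fun S _ => ce_nonneg (fun _ => mul_self_nonneg _) ω

namespace Regular

lemma error_nonneg (h : P.Regular f i γ B M D E) : 0 ≤ γ * B ^ 2 * D ^ 2 := by
  have := h.γ0
  positivity

lemma nrm_lev_sq_le (h : P.Regular f i γ B M D E) {R S : Finset ι} (hRS : R.card + S.card ≤ i) :
    P.nrm (P.lev f R S * P.lev f R S) ≤ E ^ 2 * B * D := by
  have hB := h.B0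
  have hE := h.E0
  refine (nrm_mul_le (mul_nonneg hE hB) (fun ω => h.abs_lev_le hRS ω) _).trans ?_
  calc _ ≤ E * B * (E * D) := by gcongr; exact h.nrm_lev_le hRS
    _ = _ := by ring

lemma nrm_lev_mul_le (h : P.Regular f i γ B M D E) {S T : Finset ι} (hS : S.card = i)
    (hT : T.card = i) : P.nrm (P.lev f ∅ S * P.lev f ∅ T) ≤ E ^ 2 * B * D := by
  have hB := h.B0
  have hE := h.E0
  refine (nrm_mul_le (mul_nonneg hE hB) (fun ω => h.abs_lev_le (by simp [hS]) ω) _).trans ?_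
  calc _ ≤ E * B * (E * D) := by gcongr; exact h.nrm_lev_le (by simp [hT])
    _ = _ := by ring

lemma abs_ex_lev_mul_lev_le (h : P.Regular f i γ B M D E) {R S T : Finset ι} (hST : S ≠ T)
    (hRS : Disjoint R S) (hRT : Disjoint R T) (hS : R.card + S.card ≤ i)
    (hT : R.card + T.card ≤ i) {q : Ω → ℝ} {c : ℝ} (hc : 0 ≤ c) (hq : P.Meas R q)
    (hqc : ∀ ω, |q ω| ≤ c) :
    |P.ex (q * (P.lev f R S * P.lev f R T))| ≤ E ^ 5 * γ * c * D ^ 2 := by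
  have hγ := h.γ0
  have hD := h.D0
  have hE := h.E0
  have key : ∀ {S T : Finset ι} {v : ι}, v ∈ T → v ∉ S → Disjoint R T → R.card + S.card ≤ i →
      R.card + T.card ≤ i →
      |P.ex (q * (P.lev f R S * P.lev f R T))| ≤ E ^ 5 * γ * c * D ^ 2 := by
    intro S T v hvT hvS hRT hS hT
    rw [← mul_assoc]
    have hvR : v ∉ R := disjoint_right.1 hRT hvT
    refine (h.abs_ex_mul_lev_le (G := R ∪ S) hT hvT hvR (by simp [hvR, hvS])
      ((hq.mono subset_union_left).mul (meas_lev f R S))).trans ?_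
    have : P.nrm (q * P.lev f R S) ≤ c * (E * D) :=
      (nrm_mul_le hc hqc _).trans (by gcongr; exact h.nrm_lev_le hS)
    calc _ ≤ E ^ 4 * γ * (c * (E * D)) * D := by gcongr
      _ = _ := by ring
  by_cases hsub : T ⊆ S
  · have : ¬ S ⊆ T := fun h' => hST (Subset.antisymm h' hsub)
    obtain ⟨v, hvS, hvT⟩ := not_subset.1 this
    rw [mul_comm (P.lev f R S)]
    exact key hvS hvT hRS hT hS
  · obtain ⟨v, hvT, hvS⟩ := not_subset.1 hsub
    exact key hvT hvS hRT hS hT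

/-- `⟨q f, f^{S}⟩` is close to `⟨q f^{S}, f^{S}⟩`. -/
lemma abs_ex_mul_lev_sub_le (h : P.Regular f i γ B M D E) {R S : Finset ι}
    (hRS : Disjoint R S) (hS : R.card + S.card ≤ i) {q : Ω → ℝ} {c : ℝ} (hc : 0 ≤ c)
    (hq : P.Meas R q) (hqc : ∀ ω, |q ω| ≤ c) :
    |P.ex (q * (f * P.lev f R S)) - P.ex (q * (P.lev f R S * P.lev f R S))| ≤
      E ^ 5 * γ * c * D ^ 2 := by
  have hγ := h.γ0
  have hD := h.D0
  have hE := h.E0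
  have e1 : P.ex (q * (f * P.lev f R S)) = P.ex (q * P.lev f R S * P.ce (R ∪ S) f) := by
    rw [ex_mul_ce ((hq.mono subset_union_left).mul (meas_lev f R S))]
    congr 1
    ring
  have e2 : P.lev f R S = P.ce (R ∪ S) f +
      ∑ T ∈ S.powerset.erase S, (-1 : ℝ) ^ (S \ T).card • P.ce (R ∪ T) f := by
    rw [lev, ← add_sum_erase _ _ (mem_powerset_self S)]
    simp
  have e3 : P.ex (q * (f * P.lev f R S)) - P.ex (q * (P.lev f R S * P.lev f R S)) =
      - ∑ T ∈ S.powerset.erase S, (-1 : ℝ) ^ (S \ T).card *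
        P.ex (q * P.ce (R ∪ T) f * P.lev f R S) := by
    rw [e1, ← map_sub, ← mul_assoc, ← mul_sub]
    nth_rewrite 2 [e2]
    rw [sub_add_cancel_left, mul_neg, map_neg, mul_sum, map_sum]
    congr 1
    refine sum_congr rfl fun T _ => ?_
    rw [mul_smul_comm, map_smul, smul_eq_mul]
    congr 2
    ring
  rw [e3, abs_neg]
  refine (abs_sum_le_sum_abs _ _).trans
    ((sum_le_card_nsmul _ _ (E ^ 4 * γ * (c * D) * D) fun T hT => ?_).trans ?_)
  · simp only [abs_mul, abs_pow, abs_neg, abs_one, one_pow, one_mul]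
    rw [mem_erase, mem_powerset] at hT
    obtain ⟨v, hvS, hvT⟩ := not_subset.1 fun h' => hT.1 (Subset.antisymm hT.2 h')
    have hvR : v ∉ R := disjoint_right.1 hRS hvS
    refine (h.abs_ex_mul_lev_le (G := R ∪ T) hS hvS hvR (by simp [hvR, hvT])
      ((hq.mono subset_union_left).mul (meas_ce _ _))).trans ?_
    gcongr
    refine (nrm_mul_le hc hqc _).trans ?_
    gcongr
    refine h.l2 _ ?_
    have := card_union_le R T
    have := card_le_card hT.2
    omega
  · rw [nsmul_eq_mul]
    have h1 : ((S.powerset.erase S).card : ℝ) ≤ E :=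
      le_trans (by exact_mod_cast card_le_card (erase_subset _ _))
        (h.card_powerset_le (S := S) (by omega))
    calc _ ≤ E * (E ^ 4 * γ * (c * D) * D) := by gcongr
      _ = _ := by ring

/-- An approximate Bessel inequality for the level functions above `R`. -/
lemma sum_ex_mul_lev_sq_le (h : P.Regular f i γ B M D E) {α : Type*} {R : Finset ι}
    {s : Finset α} {S : α → Finset ι} (hinj : Set.InjOn S s) (hRS : ∀ j ∈ s, Disjoint R (S j))
    (hcard : ∀ j ∈ s, R.card + (S j).card ≤ i) (hs : (s.card : ℝ) ≤ E)
    {q : Ω → ℝ} {c : ℝ} (hc : 0 ≤ c) (hq : P.Meas R q) (hq0 : ∀ ω, 0 ≤ q ω)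
    (hqc : ∀ ω, q ω ≤ c) :
    ∑ j ∈ s, P.ex (q * (P.lev f R (S j) * P.lev f R (S j))) ≤
      P.ex (q * (f * f)) + E ^ 9 * γ * c * D ^ 2 := by
  classical
  have hγ := h.γ0
  have hE := h.E0
  have hqc' : ∀ ω, |q ω| ≤ c := fun ω => by rw [abs_of_nonneg (hq0 ω)]; exact hqc ω
  set e := E ^ 5 * γ * c * D ^ 2 with he
  have he0 : 0 ≤ e := by positivity
  set L : α → Ω → ℝ := fun j => P.lev f R (S j) with hL
  have h0 : 0 ≤ P.ex (q * ((f - ∑ j ∈ s, L j) * (f - ∑ j ∈ s, L j))) :=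
    ex_nonneg fun ω => mul_nonneg (hq0 ω) (mul_self_nonneg _)
  have expand : q * ((f - ∑ j ∈ s, L j) * (f - ∑ j ∈ s, L j)) =
      q * (f * f) - (2 : ℝ) • ∑ j ∈ s, q * (f * L j) +
        ∑ j ∈ s, ∑ l ∈ s, q * (L j * L l) := by
    simp only [← mul_sum, ← sum_mul]
    ext ω
    simp
    ring
  rw [expand, map_add, map_sub, map_smul, map_sum, map_sum] at h0
  simp only [map_sum, smul_eq_mul] at h0
  have h1 : ∑ j ∈ s, P.ex (q * (L j * L j)) - s.card * e ≤ ∑ j ∈ s, P.ex (q * (f * L j)) := by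
    rw [← nsmul_eq_mul, ← sum_const, ← sum_sub_distrib]
    refine sum_le_sum fun j hj => ?_
    have := (abs_le.1 (h.abs_ex_mul_lev_sub_le (hRS j hj) (hcard j hj) hc hq hqc')).1
    simp only [hL]
    linarith
  have h2 : ∑ j ∈ s, ∑ l ∈ s, P.ex (q * (L j * L l)) ≤
      ∑ j ∈ s, (P.ex (q * (L j * L j)) + s.card * e) := by
    refine sum_le_sum fun j hj => ?_
    rw [← add_sum_erase s _ hj]
    gcongr
    refine (sum_le_card_nsmul _ _ e fun l hl => ?_).trans ?_
    · rw [mem_erase] at hl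
      exact (le_abs_self _).trans (h.abs_ex_lev_mul_lev_le
        (fun hh => hl.1 (hinj hl.2 hj hh.symm)) (hRS j hj) (hRS l hl.2) (hcard j hj)
        (hcard l hl.2) hc hq hqc')
    · rw [nsmul_eq_mul]
      have : ((s.erase j).card : ℝ) ≤ s.card := by exact_mod_cast card_le_card (erase_subset _ _)
      gcongr
  rw [sum_add_distrib, sum_const, nsmul_eq_mul] at h2
  have h3 : (s.card : ℝ) * e ≤ E * e := by gcongr
  have h4 : (s.card : ℝ) * (s.card * e) ≤ E * (E * e) := by gcongr
  have h5 : 2 * (E * e) ≤ E * (E * e) := by gcongr; exact h.two_le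
  have h6 : 2 * (E ^ 2 * e) ≤ E ^ 2 * (E ^ 2 * e) := by
    gcongr
    nlinarith [h.two_le]
  have h7 : E ^ 9 * γ * c * D ^ 2 = E ^ 2 * (E ^ 2 * e) := by rw [he]; ring
  rw [h7]
  simp only [hL] at h0 h1 h2 ⊢
  nlinarith

end Regular

end FourthMoment

end CoordSpace

namespace CoordSpace

section FourthMoment

variable {Ω ι V : Type*} [Fintype Ω] [DecidableEq ι] [Fintype ι] {P : CoordSpace Ω ι V}
  {f : Ω → ℝ} {i : ℕ} {γ B M D E : ℝ}

lemma massAbove_le {K : Finset ι} (hK : K.card ≤ i) (ω : Ω) :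
    P.massAbove f i K ω ≤ ((2 : ℝ) ^ i • ∑ R ∈ K.powerset, ∑ S ∈ powersetCard i univ with K ⊆ S,
      P.ce K (P.lev f R (S \ K) * P.lev f R (S \ K))) ω := by
  rw [sum_comm, massAbove, smul_sum, Finset.sum_apply, Finset.sum_apply]
  refine sum_le_sum fun S hS => ?_
  rw [← map_sum, ← map_smul]
  refine ce_mono (fun ω => ?_) ω
  refine (sq_lev_le (mem_filter.1 hS).2 hK ω).trans (le_of_eq ?_)
  simp

namespace Regular

lemma card_above_le (h : P.Regular f i γ B M D E) (K : Finset ι) :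
    (({S ∈ powersetCard i (univ : Finset ι) | K ⊆ S}).card : ℝ) ≤ E :=
  le_trans (by exact_mod_cast card_le_card (filter_subset _ _)) h.card_sets

lemma nrm_massAbove_le (h : P.Regular f i γ B M D E) (K : Finset ι) :
    P.nrm (P.massAbove f i K) ≤ E ^ 3 * B * D := by
  have hB := h.B0
  have hD := h.D0
  have hE := h.E0
  refine (nrm_sum_le _ _).trans
    ((sum_le_card_nsmul _ _ (E ^ 2 * B * D) fun S hS => ?_).trans ?_)
  · have := (mem_powersetCard.1 (mem_filter.1 hS).1).2
    exact (nrm_ce_le _ _).trans (h.nrm_lev_sq_le (by simp [this]))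
  · rw [nsmul_eq_mul]
    calc _ ≤ E * (E ^ 2 * B * D) := by gcongr; exact h.card_above_le K
      _ = _ := by ring

lemma massAbove_le_const (h : P.Regular f i γ B M D E) (K : Finset ι) (ω : Ω) :
    P.massAbove f i K ω ≤ E ^ 3 * B ^ 2 := by
  have hB := h.B0
  have hE := h.E0
  rw [massAbove, Finset.sum_apply]
  refine (sum_le_card_nsmul _ _ ((E * B) ^ 2) fun S hS => ?_).trans ?_
  · have := (mem_powersetCard.1 (mem_filter.1 hS).1).2
    refine ce_le (fun ω => ?_) ω
    rw [Pi.mul_apply, ← sq]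
    exact sq_le_sq' (abs_le.1 (h.abs_lev_le (by simp [this]) ω)).1
      (abs_le.1 (h.abs_lev_le (by simp [this]) ω)).2
  · rw [nsmul_eq_mul]
    calc _ ≤ E * ((E * B) ^ 2) := by gcongr; exact h.card_above_le K
      _ = _ := by ring

lemma ex_massAbove_mul_ce_le (h : P.Regular f i γ B M D E) {K R S : Finset ι} (hR : R ⊆ K)
    (hKS : K ⊆ S) (hS : S.card = i) :
    P.ex (P.massAbove f i K * P.ce K (P.lev f R (S \ K) * P.lev f R (S \ K))) ≤
      P.ex (P.ce R (P.massAbove f i K) * (P.lev f R (S \ K) * P.lev f R (S \ K))) +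
        E ^ 7 * (γ * B ^ 2 * D ^ 2) := by
  have hB := h.B0
  have hD := h.D0
  have hE := h.E0
  have hγ := h.γ0
  set Q := P.massAbove f i K
  set b := P.lev f R (S \ K) * P.lev f R (S \ K)
  have hb : P.Meas (R ∪ S \ K) b := (meas_lev _ _ _).mul (meas_lev _ _ _)
  have hcard : R.card + (S \ K).card ≤ i := by
    have := card_sdiff_add_card_eq_card hKS
    have := card_le_card hR
    omega
  have hbn : P.nrm b ≤ E ^ 2 * B * D := h.nrm_lev_sq_le hcard
  have e1 : P.ex (P.ce R Q * b) = P.ex (Q * P.ce R b) := by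
    rw [← ex_mul_ce (meas_ce R Q), mul_comm, ex_mul_ce (meas_ce R b), mul_comm]
  have e2 : P.ex (Q * P.ce K b) = P.ex (Q * P.ce R b) + P.ex (Q * (P.ce K b - P.ce R b)) := by
    rw [mul_sub, map_sub]; ring
  rw [e1, e2]
  gcongr
  refine (le_abs_self _).trans ((abs_ex_mul_le _ _).trans ?_)
  have h1 := h.nrm_ce_sub_ce_le (G := K) hR (by
    intro z
    simp only [mem_inter, mem_union, mem_sdiff]
    tauto) hb
  calc P.nrm Q * P.nrm (P.ce K b - P.ce R b)
      ≤ (E ^ 3 * B * D) * (E ^ 2 * γ * (E ^ 2 * B * D)) := by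
        gcongr
        · exact nrm_nonneg _
        · exact h.nrm_massAbove_le K
        · exact h1.trans (by gcongr)
    _ = _ := by ring

lemma ex_massAbove_sq_le (h : P.Regular f i γ B M D E) {K : Finset ι} (hK : K.card ≤ i) :
    P.ex (P.massAbove f i K * P.massAbove f i K) ≤
      4 ^ i * M * P.ex (P.massAbove f i K) + E ^ 15 * (γ * B ^ 2 * D ^ 2) := by
  have hB := h.B0
  have hD := h.D0
  have hE := h.E0
  have hγ := h.γ0
  have hM := h.M0
  have herr := h.error_nonneg
  have h2i := h.two_pow
  have hQ0 : 0 ≤ P.ex (P.massAbove f i K) := ex_nonneg (massAbove_nonneg K)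
  set Q := P.massAbove f i K with hQ
  set e := γ * B ^ 2 * D ^ 2 with he
  set s := {S ∈ powersetCard i (univ : Finset ι) | K ⊆ S} with hs
  have inner : ∀ R ∈ K.powerset,
      ∑ S ∈ s, P.ex (Q * P.ce K (P.lev f R (S \ K) * P.lev f R (S \ K))) ≤
        M * P.ex Q + E ^ 13 * e := by
    intro R hR
    rw [mem_powerset] at hR
    have hRi : R.card ≤ i := (card_le_card hR).trans hK
    have b1 : ∑ S ∈ s, P.ex (Q * P.ce K (P.lev f R (S \ K) * P.lev f R (S \ K))) ≤
        ∑ S ∈ s, P.ex (P.ce R Q * (P.lev f R (S \ K) * P.lev f R (S \ K))) +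
          E * (E ^ 7 * e) := by
      calc _ ≤ ∑ S ∈ s, (P.ex (P.ce R Q * (P.lev f R (S \ K) * P.lev f R (S \ K))) +
            E ^ 7 * e) := sum_le_sum fun S hS => by
              rw [hs, mem_filter, mem_powersetCard] at hS
              exact h.ex_massAbove_mul_ce_le hR hS.2 hS.1.2
        _ ≤ _ := by
          rw [sum_add_distrib, sum_const, nsmul_eq_mul]
          gcongr
          exact h.card_above_le K
    have b2 := h.sum_ex_mul_lev_sq_le (R := R) (s := s) (S := fun S => S \ K)
      (c := E ^ 3 * B ^ 2) (q := P.ce R Q) (by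
        intro S hS T hT hST
        rw [hs, mem_coe, mem_filter] at hS hT
        rw [← sdiff_union_of_subset hS.2, ← sdiff_union_of_subset hT.2]
        exact congrArg (· ∪ K) hST)
      (fun S _ => disjoint_sdiff.mono_left hR)
      (by
        intro S hS
        rw [hs, mem_filter, mem_powersetCard] at hS
        have := card_sdiff_add_card_eq_card hS.2
        have := card_le_card hR
        have := hS.1.2
        omega)
      (h.card_above_le K) (by positivity) (meas_ce _ _) (ce_nonneg (massAbove_nonneg K))
      (ce_le (h.massAbove_le_const K))
    have b3 : P.ex (P.ce R Q * (f * f)) ≤ M * P.ex Q := by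
      rw [← ex_mul_ce (meas_ce R Q), ← ex_ce R Q, ← smul_eq_mul M, ← map_smul P.ex]
      refine ex_mono fun ω => ?_
      rw [Pi.smul_apply, Pi.mul_apply, smul_eq_mul, mul_comm]
      exact mul_le_mul_of_nonneg_right (h.var R hRi ω) (ce_nonneg (massAbove_nonneg K) ω)
    have b4 : E ^ 8 * e + E ^ 12 * e ≤ E ^ 13 * e := by
      have c1 : E ^ 8 ≤ E ^ 12 := pow_le_pow_right₀ h.one_le (by norm_num)
      have c2 : 2 * E ^ 12 ≤ E * E ^ 12 := by gcongr; exact h.two_le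
      rw [← add_mul]
      gcongr
      linarith
    have b5 : E ^ 9 * γ * (E ^ 3 * B ^ 2) * D ^ 2 = E ^ 12 * e := by rw [he]; ring
    linarith
  have step : P.ex (Q * Q) ≤ 2 ^ i * ∑ R ∈ K.powerset, ∑ S ∈ s,
      P.ex (Q * P.ce K (P.lev f R (S \ K) * P.lev f R (S \ K))) := by
    have e1 : P.ex (Q * ((2 : ℝ) ^ i • ∑ R ∈ K.powerset, ∑ S ∈ s,
        P.ce K (P.lev f R (S \ K) * P.lev f R (S \ K)))) = 2 ^ i * ∑ R ∈ K.powerset, ∑ S ∈ s,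
      P.ex (Q * P.ce K (P.lev f R (S \ K) * P.lev f R (S \ K))) := by
      rw [mul_smul_comm, map_smul, smul_eq_mul, mul_sum, map_sum]
      simp only [mul_sum (a := Q), map_sum]
    rw [← e1]
    exact ex_mono fun ω => mul_le_mul_of_nonneg_left (massAbove_le hK ω) (massAbove_nonneg K ω)
  refine step.trans ?_
  have hc : (K.powerset.card : ℝ) ≤ 2 ^ i := by
    rw [card_powerset]
    exact_mod_cast Nat.pow_le_pow_right (by norm_num) hK
  calc _ ≤ (2 : ℝ) ^ i * (2 ^ i * (M * P.ex Q + E ^ 13 * e)) := by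
        gcongr
        refine (sum_le_card_nsmul _ _ _ inner).trans ?_
        rw [nsmul_eq_mul]
        gcongr
    _ = 4 ^ i * M * P.ex Q + (2 ^ i * 2 ^ i) * (E ^ 13 * e) := by
        rw [show (4 : ℝ) = 2 * 2 by norm_num, mul_pow]; ring
    _ ≤ 4 ^ i * M * P.ex Q + (E * E) * (E ^ 13 * e) := by gcongr
    _ = _ := by ring

end Regular

end FourthMoment

end CoordSpace

namespace CoordSpace

section Pairs

variable {Ω ι V : Type*} [Fintype Ω] [DecidableEq ι] [Fintype ι] {P : CoordSpace Ω ι V}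
  {f : Ω → ℝ} {i : ℕ} {γ B M D E : ℝ}

/-- `W` covers the symmetric difference of the two sets and lies inside their union. -/
def Covers (p : Finset ι × Finset ι) (W : Finset ι) : Prop :=
  p.1 \ p.2 ⊆ W ∧ p.2 \ p.1 ⊆ W ∧ W ⊆ p.1 ∪ p.2

instance (p : Finset ι × Finset ι) (W : Finset ι) : Decidable (Covers p W) :=
  inferInstanceAs (Decidable (_ ∧ _))

variable (P f) in
/-- The product of the two components of `f` indexed by a pair of sets. -/
noncomputable def pairLev (p : Finset ι × Finset ι) : Ω → ℝ := P.lev f ∅ p.1 * P.lev f ∅ p.2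

variable (ι i) in
/-- All pairs of `i`-element sets. -/
def pairs : Finset (Finset ι × Finset ι) := powersetCard i univ ×ˢ powersetCard i univ

lemma mem_pairs {p : Finset ι × Finset ι} : p ∈ pairs ι i ↔ p.1.card = i ∧ p.2.card = i := by
  simp [pairs, mem_powersetCard]

variable (P f i) in
/-- The conditional mass, given the coordinates in `W`, of all pairs covered by `W`. -/
noncomputable def pairMass (W : Finset ι) : Ω → ℝ :=
  ∑ p ∈ pairs ι i with Covers p W, P.ce W |P.pairLev f p|

lemma meas_lev_empty (S : Finset ι) : P.Meas S (P.lev f ∅ S) := by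
  simpa using meas_lev (P := P) f ∅ S

lemma meas_pairLev (p : Finset ι × Finset ι) : P.Meas (p.1 ∪ p.2) (P.pairLev f p) :=
  ((meas_lev_empty p.1).mono subset_union_left).mul ((meas_lev_empty p.2).mono subset_union_right)

lemma level_sq : P.level f i * P.level f i = ∑ p ∈ pairs ι i, P.pairLev f p := by
  rw [level, sum_mul_sum, pairs, sum_product]
  rfl

lemma ce_abs_nonneg (W : Finset ι) (φ : Ω → ℝ) (ω : Ω) : 0 ≤ P.ce W |φ| ω :=
  ce_nonneg (fun _ => abs_nonneg _) ω

namespace Regular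

lemma card_pairs_le (h : P.Regular f i γ B M D E) : ((pairs ι i).card : ℝ) ≤ E ^ 2 := by
  have := h.card_sets
  have := h.E0
  rw [pairs, card_product, Nat.cast_mul, sq]
  gcongr

lemma sum_ex_lev_sq_le (h : P.Regular f i γ B M D E) :
    ∑ S ∈ powersetCard i univ, P.ex (P.lev f ∅ S * P.lev f ∅ S) ≤
      P.ex (P.level f i * P.level f i) + E ^ 7 * γ * D ^ 2 := by
  have hγ := h.γ0
  have hE := h.E0
  have hs := h.card_sets
  set c := E ^ 5 * γ * D ^ 2 with hc
  have hc0 : 0 ≤ c := by positivity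
  have key : ∀ S ∈ powersetCard i (univ : Finset ι), P.ex (P.lev f ∅ S * P.lev f ∅ S) ≤
      ∑ T ∈ powersetCard i univ, (P.ex (P.lev f ∅ S * P.lev f ∅ T) + c) := by
    intro S hS
    refine le_trans (le_add_of_nonneg_right hc0) (single_le_sum
      (f := fun T => P.ex (P.lev f ∅ S * P.lev f ∅ T) + c) (fun T hT => ?_) hS)
    rcases eq_or_ne S T with rfl | hST
    · exact add_nonneg (ex_mul_self_nonneg _) hc0
    · have := h.abs_ex_lev_mul_lev_le (R := ∅) hST (disjoint_empty_left _) (disjoint_empty_left _)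
        (by simp [(mem_powersetCard.1 hS).2]) (by simp [(mem_powersetCard.1 hT).2]) (q := 1)
        zero_le_one (fun _ _ _ => rfl) (fun _ => by simp)
      rw [one_mul, mul_one] at this
      linarith [(abs_le.1 this).1]
  refine (sum_le_sum key).trans ?_
  have e1 : P.ex (P.level f i * P.level f i) = ∑ S ∈ powersetCard i univ,
      ∑ T ∈ powersetCard i univ, P.ex (P.lev f ∅ S * P.lev f ∅ T) := by
    simp only [level, sum_mul_sum, map_sum]
  simp only [sum_add_distrib, sum_const, nsmul_eq_mul]
  rw [e1, add_le_add_iff_left]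
  calc _ ≤ E * (E * c) := by gcongr
    _ = _ := by rw [hc]; ring

lemma nrm_pairLev_le (h : P.Regular f i γ B M D E) {p : Finset ι × Finset ι}
    (hp : p ∈ pairs ι i) : P.nrm (P.pairLev f p) ≤ E ^ 2 * B * D :=
  h.nrm_lev_mul_le (mem_pairs.1 hp).1 (mem_pairs.1 hp).2

lemma abs_ex_prod_lev_le (h : P.Regular f i γ B M D E) {S T : Finset ι}
    {q : Finset ι × Finset ι} (hS : S.card = i) (hT : T.card = i) (hq : q ∈ pairs ι i) {v : ι}
    (hv : v ∈ S) (hvT : v ∉ T) (hvq : v ∉ q.1 ∪ q.2) :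
    |P.ex (P.pairLev f q * P.lev f ∅ T * P.lev f ∅ S)| ≤ E ^ 7 * (γ * B ^ 2 * D ^ 2) := by
  have hγ := h.γ0
  have hB := h.B0
  have hD := h.D0
  have hE := h.E0
  refine (h.abs_ex_mul_lev_le (G := q.1 ∪ q.2 ∪ T) (by simp [hS]) hv (notMem_empty v)
    (by rw [mem_union]; tauto) (((meas_pairLev q).mono subset_union_left).mul
      ((meas_lev_empty T).mono subset_union_right))).trans ?_
  have hn : P.nrm (P.pairLev f q * P.lev f ∅ T) ≤ E * B * (E ^ 2 * B * D) := by
    rw [mul_comm]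
    refine (nrm_mul_le (mul_nonneg hE hB) (fun ω => h.abs_lev_le (by simp [hT]) ω) _).trans ?_
    gcongr
    exact h.nrm_pairLev_le hq
  calc _ ≤ E ^ 4 * γ * (E * B * (E ^ 2 * B * D)) * D := by gcongr
    _ = _ := by ring

lemma ex_pairLev_mul_le (h : P.Regular f i γ B M D E) {p q : Finset ι × Finset ι}
    (hp : p ∈ pairs ι i) (hq : q ∈ pairs ι i) :
    P.ex (P.pairLev f p * P.pairLev f q) ≤ E ^ 7 * (γ * B ^ 2 * D ^ 2) +
      ∑ W : Finset ι, if Covers p W ∧ Covers q W then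
        P.ex (P.ce W |P.pairLev f p| * P.ce W |P.pairLev f q|) else 0 := by
  have hE := h.E0
  have hB := h.B0
  have hD := h.D0
  have hγ := h.γ0
  have herr := h.error_nonneg
  have hnn : ∀ W, 0 ≤ P.ex (P.ce W |P.pairLev f p| * P.ce W |P.pairLev f q|) := fun W =>
    ex_nonneg fun ω => mul_nonneg (ce_abs_nonneg W _ ω) (ce_abs_nonneg W _ ω)
  have hnn' : ∀ W : Finset ι, 0 ≤ (if Covers p W ∧ Covers q W then
      P.ex (P.ce W |P.pairLev f p| * P.ce W |P.pairLev f q|) else 0) := fun W => by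
    split_ifs
    exacts [hnn W, le_rfl]
  have hp' := mem_pairs.1 hp
  have hq' := mem_pairs.1 hq
  set W := (p.1 ∪ p.2) ∩ (q.1 ∪ q.2) with hW
  by_cases hg : Covers p W ∧ Covers q W
  · have h1 := single_le_sum (f := fun W => if Covers p W ∧ Covers q W then
      P.ex (P.ce W |P.pairLev f p| * P.ce W |P.pairLev f q|) else 0) (fun W _ => hnn' W)
      (mem_univ W)
    rw [if_pos hg] at h1
    have h2 := (abs_le.1 (h.near_indep (C := W) le_rfl (meas_pairLev (P := P) (f := f) p).abs
      (meas_pairLev (P := P) (f := f) q).abs)).2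
    rw [nrm_abs, nrm_abs] at h2
    have h3 : P.ex (P.pairLev f p * P.pairLev f q) ≤ P.ex (|P.pairLev f p| * |P.pairLev f q|) :=
      ex_mono fun ω => by
        simp only [Pi.mul_apply, Pi.abs_apply, ← abs_mul]
        exact le_abs_self _
    have h4 : E ^ 2 * γ * P.nrm (P.pairLev f p) * P.nrm (P.pairLev f q) ≤
        E ^ 7 * (γ * B ^ 2 * D ^ 2) := by
      calc _ ≤ E ^ 2 * γ * (E ^ 2 * B * D) * (E ^ 2 * B * D) := by
            gcongr
            exacts [nrm_nonneg _, h.nrm_pairLev_le hp, h.nrm_pairLev_le hq]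
        _ = E ^ 6 * (γ * B ^ 2 * D ^ 2) := by ring
        _ ≤ _ := by gcongr; exacts [h.one_le, by norm_num]
    linarith
  · refine le_trans ?_ (le_add_of_nonneg_right (sum_nonneg fun W _ => hnn' W))
    refine (le_abs_self _).trans ?_
    have hcases : ¬ p.1 \ p.2 ⊆ W ∨ ¬ p.2 \ p.1 ⊆ W ∨ ¬ q.1 \ q.2 ⊆ W ∨ ¬ q.2 \ q.1 ⊆ W := by
      by_contra! hcon
      exact hg ⟨⟨hcon.1, hcon.2.1, inter_subset_left⟩,
        ⟨hcon.2.2.1, hcon.2.2.2, inter_subset_right⟩⟩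
    simp only [not_subset, mem_sdiff, hW, mem_inter, mem_union] at hcases
    rcases hcases with ⟨v, hv, hvW⟩ | ⟨v, hv, hvW⟩ | ⟨v, hv, hvW⟩ | ⟨v, hv, hvW⟩
    · rw [show P.pairLev f p * P.pairLev f q =
        P.pairLev f q * P.lev f ∅ p.2 * P.lev f ∅ p.1 by simp only [pairLev]; ring]
      exact h.abs_ex_prod_lev_le hp'.1 hp'.2 hq hv.1 hv.2 (by rw [mem_union]; tauto)
    · rw [show P.pairLev f p * P.pairLev f q =
        P.pairLev f q * P.lev f ∅ p.1 * P.lev f ∅ p.2 by simp only [pairLev]; ring]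
      exact h.abs_ex_prod_lev_le hp'.2 hp'.1 hq hv.1 hv.2 (by rw [mem_union]; tauto)
    · rw [show P.pairLev f p * P.pairLev f q =
        P.pairLev f p * P.lev f ∅ q.2 * P.lev f ∅ q.1 by simp only [pairLev]; ring]
      exact h.abs_ex_prod_lev_le hq'.1 hq'.2 hp hv.1 hv.2 (by rw [mem_union]; tauto)
    · rw [show P.pairLev f p * P.pairLev f q =
        P.pairLev f p * P.lev f ∅ q.1 * P.lev f ∅ q.2 by simp only [pairLev]; ring]
      exact h.abs_ex_prod_lev_le hq'.2 hq'.1 hp hv.1 hv.2 (by rw [mem_union]; tauto)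

lemma ex_level_four_le (h : P.Regular f i γ B M D E) :
    P.ex (P.level f i * P.level f i * (P.level f i * P.level f i)) ≤
      E ^ 11 * (γ * B ^ 2 * D ^ 2) +
        ∑ W : Finset ι, P.ex (P.pairMass f i W * P.pairMass f i W) := by
  have hE := h.E0
  have herr := h.error_nonneg
  have hcard := h.card_pairs_le
  have e1 : ∀ W : Finset ι, P.ex (P.pairMass f i W * P.pairMass f i W) =
      ∑ p ∈ pairs ι i, ∑ q ∈ pairs ι i, if Covers p W ∧ Covers q W then
        P.ex (P.ce W |P.pairLev f p| * P.ce W |P.pairLev f q|) else 0 := by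
    intro W
    rw [pairMass, sum_mul_sum, map_sum, sum_filter]
    refine sum_congr rfl fun p _ => ?_
    rw [map_sum, sum_filter]
    split_ifs with hW <;> simp [hW]
  rw [level_sq, sum_mul_sum, map_sum, sum_congr rfl fun W _ => e1 W, sum_comm]
  calc _ ≤ ∑ p ∈ pairs ι i, ((E ^ 2 * (E ^ 7 * (γ * B ^ 2 * D ^ 2))) +
        ∑ q ∈ pairs ι i, ∑ W : Finset ι, if Covers p W ∧ Covers q W then
          P.ex (P.ce W |P.pairLev f p| * P.ce W |P.pairLev f q|) else 0) := by
        refine sum_le_sum fun p hp => ?_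
        rw [map_sum]
        refine (sum_le_sum fun q hq => h.ex_pairLev_mul_le hp hq).trans ?_
        rw [sum_add_distrib, sum_const, nsmul_eq_mul]
        gcongr
    _ ≤ _ := by
        rw [sum_add_distrib, sum_const, nsmul_eq_mul]
        refine add_le_add ?_ (le_of_eq (sum_congr rfl fun p _ => sum_comm))
        calc _ ≤ E ^ 2 * (E ^ 2 * (E ^ 7 * (γ * B ^ 2 * D ^ 2))) := by gcongr
          _ = _ := by ring

end Regular

end Pairs

end CoordSpace

namespace CoordSpace

section Hypercontractive

variable {Ω ι V : Type*} [Fintype Ω] [DecidableEq ι] [Fintype ι] {P : CoordSpace Ω ι V}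
  {f : Ω → ℝ} {i : ℕ} {γ B M D E : ℝ}

variable (P f) in
/-- The square of a component of `f`, averaged over the coordinates outside `W`. -/
noncomputable def condSq (W S : Finset ι) : Ω → ℝ := P.ce W (P.lev f ∅ S * P.lev f ∅ S)

lemma condSq_nonneg (W S : Finset ι) (ω : Ω) : 0 ≤ P.condSq f W S ω :=
  ce_nonneg (fun _ => mul_self_nonneg _) ω

lemma ex_condSq_mul_nonneg (W S T : Finset ι) : 0 ≤ P.ex (P.condSq f W S * P.condSq f W T) :=
  ex_nonneg fun ω => mul_nonneg (condSq_nonneg W S ω) (condSq_nonneg W T ω)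

lemma pairMass_sq_le (W : Finset ι) (ω : Ω) :
    (P.pairMass f i W * P.pairMass f i W) ω ≤ 16 ^ i *
      ∑ w ∈ W.powerset ×ˢ W.powerset with w.1 ∪ w.2 = W,
        (∑ S ∈ powersetCard i univ with S ∩ W = w.1, P.condSq f W S ω) *
          ∑ S ∈ powersetCard i univ with S ∩ W = w.2, P.condSq f W S ω := by
  set Z := {w ∈ W.powerset ×ˢ W.powerset | w.1 ∪ w.2 = W}
  set G := {p ∈ pairs ι i | Covers p W}
  have hR : 0 ≤ ∑ w ∈ Z, (∑ S ∈ powersetCard i univ with S ∩ W = w.1, P.condSq f W S ω) *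
      ∑ S ∈ powersetCard i univ with S ∩ W = w.2, P.condSq f W S ω :=
    sum_nonneg fun w _ => mul_nonneg (sum_nonneg fun S _ => condSq_nonneg W S ω)
      (sum_nonneg fun S _ => condSq_nonneg W S ω)
  rcases G.eq_empty_or_nonempty with hG | ⟨p₀, hp₀⟩
  · have : P.pairMass f i W = 0 := by
      rw [pairMass]
      exact (congrArg (fun s => ∑ p ∈ s, P.ce W |P.pairLev f p|) hG).trans sum_empty
    rw [this, mul_zero, Pi.zero_apply]
    positivity
  have hW : W.card ≤ 2 * i := by
    obtain ⟨hp, hc⟩ := mem_filter.1 hp₀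
    have h1 := card_le_card hc.2.2
    have h2 := card_union_le p₀.1 p₀.2
    have h3 := mem_pairs.1 hp
    omega
  have hZ : (Z.card : ℝ) ≤ 16 ^ i := by
    have h1 : Z.card ≤ 2 ^ W.card * 2 ^ W.card :=
      (card_filter_le _ _).trans (by rw [card_product, card_powerset])
    have h2 : 2 ^ W.card ≤ 2 ^ (2 * i) := Nat.pow_le_pow_right (by norm_num) hW
    have h3 : 2 ^ (2 * i) * 2 ^ (2 * i) = 16 ^ i := by
      rw [pow_mul, ← mul_pow]
      norm_num
    exact_mod_cast (h1.trans (Nat.mul_le_mul h2 h2)).trans h3.le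
  have hmaps : ∀ p ∈ G, (p.1 ∩ W, p.2 ∩ W) ∈ Z := by
    intro p hp
    have hc := (mem_filter.1 hp).2
    refine mem_filter.2 ⟨mem_product.2 ⟨?_, ?_⟩, ?_⟩
    · exact mem_powerset.2 inter_subset_right
    · exact mem_powerset.2 inter_subset_right
    · rw [← union_inter_distrib_right, inter_eq_right]
      exact hc.2.2
  have hx : P.pairMass f i W ω = ∑ w ∈ Z, ∑ p ∈ G with (p.1 ∩ W, p.2 ∩ W) = w,
      P.ce W |P.pairLev f p| ω := by
    rw [pairMass, Finset.sum_apply, sum_fiberwise_of_maps_to hmaps]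
  rw [Pi.mul_apply, ← sq, hx]
  refine sq_sum_le_card_mul_sum_sq.trans ?_
  refine mul_le_mul hZ (sum_le_sum fun w _ => ?_) (sum_nonneg fun _ _ => sq_nonneg _)
    (by positivity)
  refine (sq_sum_ce_le _ W (fun p : Finset ι × Finset ι => P.lev f ∅ p.1)
    (fun p => P.lev f ∅ p.2) ω).trans ?_
  have hset : ∀ p ∈ G.filter (fun p => (p.1 ∩ W, p.2 ∩ W) = w),
      (p.1.card = i ∧ p.2.card = i) ∧ (p.1 \ p.2 ⊆ W ∧ p.2 \ p.1 ⊆ W) ∧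
        p.1 ∩ W = w.1 ∧ p.2 ∩ W = w.2 := by
    intro p hp
    obtain ⟨hpG, rfl⟩ := mem_filter.1 hp
    obtain ⟨hpp, hc⟩ := mem_filter.1 hpG
    exact ⟨mem_pairs.1 hpp, ⟨hc.1, hc.2.1⟩, rfl, rfl⟩
  have hfst : ∀ p : Finset ι × Finset ι, p.1 \ p.2 ⊆ W → p.2 \ p.1 ⊆ W →
      p.1 = p.1 ∩ W ∪ p.2 \ W ∧ p.2 = p.2 ∩ W ∪ p.1 \ W := by
    intro p h1 h2
    constructor <;> ext z <;> have h1z := @h1 z <;> have h2z := @h2 z <;>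
      simp only [mem_union, mem_inter, mem_sdiff] at * <;> tauto
  refine mul_le_mul ?_ ?_ (sum_nonneg fun S _ => condSq_nonneg W _ ω)
    (sum_nonneg fun S _ => condSq_nonneg W S ω)
  · refine (sum_image (f := fun S => P.condSq f W S ω) (g := Prod.fst) ?_).symm.le.trans
      (sum_le_sum_of_subset_of_nonneg ?_ fun S _ _ => condSq_nonneg W S ω)
    · intro p hp q hq hpq
      have h1 := hset p hp
      have h2 := hset q hq
      refine Prod.ext hpq ?_
      rw [(hfst p h1.2.1.1 h1.2.1.2).2, (hfst q h2.2.1.1 h2.2.1.2).2, hpq, h1.2.2.2, h2.2.2.2]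
    · refine image_subset_iff.2 fun p hp => ?_
      have := hset p hp
      exact mem_filter.2 ⟨mem_powersetCard.2 ⟨subset_univ _, this.1.1⟩, this.2.2.1⟩
  · refine (sum_image (f := fun S => P.condSq f W S ω) (g := Prod.snd) ?_).symm.le.trans
      (sum_le_sum_of_subset_of_nonneg ?_ fun S _ _ => condSq_nonneg W S ω)
    · intro p hp q hq hpq
      have h1 := hset p hp
      have h2 := hset q hq
      refine Prod.ext ?_ hpq
      rw [(hfst p h1.2.1.1 h1.2.1.2).1, (hfst q h2.2.1.1 h2.2.1.2).1, hpq, h1.2.2.1, h2.2.2.1]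
    · refine image_subset_iff.2 fun p hp => ?_
      have := hset p hp
      exact mem_filter.2 ⟨mem_powersetCard.2 ⟨subset_univ _, this.1.2⟩, this.2.2.2⟩

lemma sum_condSq_eq_massAbove (K : Finset ι) :
    ∑ S ∈ powersetCard i univ with K ⊆ S, P.condSq f K S = P.massAbove f i K := rfl

namespace Regular

lemma ex_condSq_mul_le (h : P.Regular f i γ B M D E) {S T : Finset ι} (hS : S.card = i)
    (hT : T.card = i) {W W₁ W₂ : Finset ι} (hW : W₁ ∪ W₂ = W) (h1 : S ∩ W = W₁)
    (h2 : T ∩ W = W₂) :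
    P.ex (P.condSq f W S * P.condSq f W T) ≤
      P.ex (P.condSq f (W₁ ∩ W₂) S * P.condSq f (W₁ ∩ W₂) T) +
        E ^ 7 * (γ * B ^ 2 * D ^ 2) := by
  have hE := h.E0
  have hB := h.B0
  have hD := h.D0
  have hγ := h.γ0
  have herr := h.error_nonneg
  have hmS : P.Meas S (P.lev f ∅ S * P.lev f ∅ S) := (meas_lev_empty S).mul (meas_lev_empty S)
  have hmT : P.Meas T (P.lev f ∅ T * P.lev f ∅ T) := (meas_lev_empty T).mul (meas_lev_empty T)
  have hnS := h.nrm_lev_mul_le hS hS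
  have hnT := h.nrm_lev_mul_le hT hT
  simp only [condSq]
  set b := P.lev f ∅ S * P.lev f ∅ S
  set c := P.lev f ∅ T * P.lev f ∅ T
  rw [ex_mul_ce (meas_ce W b)]
  have e1 : P.ex (P.ce W b * c) = P.ex (P.ce W₁ b * c) + P.ex ((P.ce W b - P.ce W₁ b) * c) := by
    rw [sub_mul, map_sub]; ring
  have hd := h.nrm_ce_sub_ce_le (G := W) (C := W₁) (by rw [← hW]; exact subset_union_left)
    (by rw [inter_comm, h1]) hmS
  have i1 := (abs_le.1 (abs_ex_mul_le (P := P) (P.ce W b - P.ce W₁ b) c)).2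
  have i2 : P.nrm (P.ce W b - P.ce W₁ b) * P.nrm c ≤ E ^ 6 * (γ * B ^ 2 * D ^ 2) := by
    calc _ ≤ (E ^ 2 * γ * (E ^ 2 * B * D)) * (E ^ 2 * B * D) := by
          gcongr
          · exact nrm_nonneg _
          · exact hd.trans (by gcongr)
      _ = _ := by ring
  have i3 := (abs_le.1 (h.near_indep (C := W₁ ∩ W₂) (by
    intro z
    have hz : z ∈ T ∩ W ↔ z ∈ W₂ := by rw [h2]
    rw [← hW] at hz
    simp only [mem_inter, mem_union] at hz ⊢
    tauto) (meas_ce W₁ b) hmT)).2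
  rw [ce_ce_of_subset inter_subset_left] at i3
  have i4 : E ^ 2 * γ * P.nrm (P.ce W₁ b) * P.nrm c ≤ E ^ 6 * (γ * B ^ 2 * D ^ 2) := by
    calc _ ≤ E ^ 2 * γ * (E ^ 2 * B * D) * (E ^ 2 * B * D) := by
          gcongr
          · exact nrm_nonneg _
          · exact (nrm_ce_le _ _).trans hnS
      _ = _ := by ring
  have i5 : 2 * (E ^ 6 * (γ * B ^ 2 * D ^ 2)) ≤ E ^ 7 * (γ * B ^ 2 * D ^ 2) := by
    calc _ ≤ E * (E ^ 6 * (γ * B ^ 2 * D ^ 2)) := by gcongr; exact h.two_le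
      _ = _ := by ring
  linarith

lemma sum_ex_pairMass_sq_le (h : P.Regular f i γ B M D E) :
    ∑ W : Finset ι, P.ex (P.pairMass f i W * P.pairMass f i W) ≤
      64 ^ i * ∑ S ∈ powersetCard i univ, ∑ T ∈ powersetCard i univ, ∑ K ∈ (S ∩ T).powerset,
        (P.ex (P.condSq f K S * P.condSq f K T) + E ^ 7 * (γ * B ^ 2 * D ^ 2)) := by
  have hE := h.E0
  have herr := h.error_nonneg
  set e := γ * B ^ 2 * D ^ 2
  set t : Finset ι → Finset ι → Finset ι → ℝ := fun S T K =>
    P.ex (P.condSq f K S * P.condSq f K T) + E ^ 7 * e with ht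
  have ht0 : ∀ S T K, 0 ≤ t S T K := fun S T K =>
    add_nonneg (ex_condSq_mul_nonneg K S T) (by positivity)
  have step : ∀ W : Finset ι, P.ex (P.pairMass f i W * P.pairMass f i W) ≤ 16 ^ i *
      ∑ S ∈ powersetCard i univ, ∑ T ∈ powersetCard i univ,
        ∑ w ∈ S.powerset ×ˢ T.powerset with w.1 ∪ w.2 = W, t S T (w.1 ∩ w.2) := by
    intro W
    have h1 : P.ex (P.pairMass f i W * P.pairMass f i W) ≤
        P.ex ((16 : ℝ) ^ i • ∑ w ∈ W.powerset ×ˢ W.powerset with w.1 ∪ w.2 = W,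
          ∑ S ∈ powersetCard i univ, ∑ T ∈ powersetCard i univ,
            if S ∩ W = w.1 ∧ T ∩ W = w.2 then P.condSq f W S * P.condSq f W T else 0) := by
      refine ex_mono fun ω => (pairMass_sq_le W ω).trans (le_of_eq ?_)
      rw [Pi.smul_apply, smul_eq_mul, Finset.sum_apply]
      congr 1
      refine sum_congr rfl fun w _ => ?_
      rw [sum_mul_sum, sum_filter, Finset.sum_apply]
      refine sum_congr rfl fun S _ => ?_
      rw [sum_filter, Finset.sum_apply]
      split_ifs with hS
      · refine sum_congr rfl fun T _ => ?_
        by_cases hT : T ∩ W = w.2 <;> simp [hS, hT]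
      · simp [hS]
    refine h1.trans ?_
    rw [map_smul, smul_eq_mul]
    gcongr
    simp only [map_sum]
    rw [sum_comm]
    refine sum_le_sum fun S hS => ?_
    rw [sum_comm]
    refine sum_le_sum fun T hT => ?_
    rw [mem_powersetCard] at hS hT
    calc _ ≤ ∑ w ∈ W.powerset ×ˢ W.powerset with w.1 ∪ w.2 = W,
          if S ∩ W = w.1 ∧ T ∩ W = w.2 then t S T (w.1 ∩ w.2) else 0 := by
          refine sum_le_sum fun w hw => ?_
          split_ifs with hc
          · exact h.ex_condSq_mul_le hS.2 hT.2 (mem_filter.1 hw).2 hc.1 hc.2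
          · rw [map_zero]
      _ ≤ _ := by
          rw [← sum_filter]
          refine sum_le_sum_of_subset_of_nonneg ?_ fun w _ _ => ht0 _ _ _
          intro w hw
          obtain ⟨hw, hc⟩ := mem_filter.1 hw
          refine mem_filter.2 ⟨mem_product.2 ⟨mem_powerset.2 ?_, mem_powerset.2 ?_⟩,
            (mem_filter.1 hw).2⟩
          · rw [← hc.1]; exact inter_subset_left
          · rw [← hc.2]; exact inter_subset_left
  refine (sum_le_sum fun W _ => step W).trans ?_
  rw [← mul_sum, sum_comm, show (64 : ℝ) = 16 * 4 by norm_num, mul_pow, mul_assoc]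
  refine mul_le_mul_of_nonneg_left ?_ (by positivity)
  rw [mul_sum]
  refine sum_le_sum fun S hS => ?_
  rw [sum_comm, mul_sum]
  refine sum_le_sum fun T hT => ?_
  rw [sum_fiberwise]
  rw [mem_powersetCard] at hS hT
  calc _ ≤ ∑ w ∈ S.powerset ×ˢ T.powerset, ∑ K ∈ (S ∩ T).powerset, t S T K := by
        refine sum_le_sum fun w hw => ?_
        rw [mem_product, mem_powerset, mem_powerset] at hw
        exact single_le_sum (f := fun K => t S T K) (fun K _ => ht0 S T K)
          (mem_powerset.2 (inter_subset_inter hw.1 hw.2))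
    _ = 4 ^ i * ∑ K ∈ (S ∩ T).powerset, t S T K := by
        rw [sum_const, nsmul_eq_mul, card_product, card_powerset, card_powerset, hS.2, hT.2,
          ← mul_pow]
        norm_num

lemma sum_ex_condSq_le (h : P.Regular f i γ B M D E) :
    ∑ S ∈ powersetCard i univ, ∑ T ∈ powersetCard i univ, ∑ K ∈ (S ∩ T).powerset,
        (P.ex (P.condSq f K S * P.condSq f K T) + E ^ 7 * (γ * B ^ 2 * D ^ 2)) ≤
      8 ^ i * M * (∑ S ∈ powersetCard i univ, P.ex (P.lev f ∅ S * P.lev f ∅ S)) +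
        E ^ 18 * (γ * B ^ 2 * D ^ 2) := by
  have hE := h.E0
  have hM := h.M0
  have hs := h.card_sets
  have herr := h.error_nonneg
  set e := γ * B ^ 2 * D ^ 2
  set 𝒮 := powersetCard i (univ : Finset ι) with h𝒮
  set 𝒦 := 𝒮.biUnion powerset with h𝒦
  have hcard𝒦 : (𝒦.card : ℝ) ≤ E ^ 2 := by
    have h1 : 𝒦.card ≤ 𝒮.card * 2 ^ i := card_biUnion_le_card_mul _ _ _ fun S hS => by
      rw [card_powerset, (mem_powersetCard.1 hS).2]
    have h2 : (𝒦.card : ℝ) ≤ 𝒮.card * 2 ^ i := by exact_mod_cast h1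
    rw [sq]
    exact h2.trans (mul_le_mul hs h.two_pow (by positivity) hE)
  have hsum : ∀ g : Finset ι → Finset ι → ℝ, ∑ S ∈ 𝒮, ∑ K ∈ S.powerset, g S K =
      ∑ K ∈ 𝒦, ∑ S ∈ 𝒮 with K ⊆ S, g S K := by
    intro g
    refine sum_comm' fun S K => ?_
    simp only [h𝒦, mem_biUnion, mem_filter, mem_powerset]
    exact ⟨fun H => ⟨⟨H.1, H.2⟩, S, H.1, H.2⟩, fun H => H.1⟩
  have hmain : ∑ S ∈ 𝒮, ∑ T ∈ 𝒮, ∑ K ∈ (S ∩ T).powerset, P.ex (P.condSq f K S * P.condSq f K T) =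
      ∑ K ∈ 𝒦, P.ex (P.massAbove f i K * P.massAbove f i K) := by
    have e1 : ∀ S T : Finset ι, ∑ K ∈ (S ∩ T).powerset, P.ex (P.condSq f K S * P.condSq f K T) =
        ∑ K ∈ S.powerset, if K ⊆ T then P.ex (P.condSq f K S * P.condSq f K T) else 0 := by
      intro S T
      rw [← sum_filter]
      refine sum_congr ?_ fun _ _ => rfl
      ext K
      simp only [mem_filter, mem_powerset, subset_inter_iff]
    simp only [e1]
    rw [sum_congr rfl fun S _ => sum_comm, hsum]
    refine sum_congr rfl fun K _ => ?_
    rw [← sum_condSq_eq_massAbove, sum_mul_sum, map_sum]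
    refine sum_congr rfl fun S _ => ?_
    rw [map_sum, sum_filter]
  have herror : ∑ S ∈ 𝒮, ∑ T ∈ 𝒮, ∑ _K ∈ (S ∩ T).powerset, E ^ 7 * e ≤ E ^ 10 * e := by
    have h1 : ∀ S ∈ 𝒮, ∑ T ∈ 𝒮, ∑ _K ∈ (S ∩ T).powerset, E ^ 7 * e ≤ E * (E * (E ^ 7 * e)) := by
      intro S hS
      calc _ ≤ ∑ T ∈ 𝒮, E * (E ^ 7 * e) := by
            refine sum_le_sum fun T _ => ?_
            rw [sum_const, nsmul_eq_mul]
            gcongr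
            exact h.card_powerset_le
              ((card_le_card inter_subset_left).trans (mem_powersetCard.1 hS).2.le)
        _ ≤ _ := by
            rw [sum_const, nsmul_eq_mul]
            gcongr
    calc _ ≤ ∑ _S ∈ 𝒮, E * (E * (E ^ 7 * e)) := sum_le_sum h1
      _ ≤ E * (E * (E * (E ^ 7 * e))) := by
          rw [sum_const, nsmul_eq_mul]
          gcongr
      _ = _ := by ring
  have hQ : ∑ K ∈ 𝒦, P.ex (P.massAbove f i K) =
      2 ^ i * ∑ S ∈ 𝒮, P.ex (P.lev f ∅ S * P.lev f ∅ S) := by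
    have e1 : ∀ K, P.ex (P.massAbove f i K) =
        ∑ S ∈ 𝒮 with K ⊆ S, P.ex (P.lev f ∅ S * P.lev f ∅ S) := by
      intro K
      rw [massAbove, map_sum]
      exact sum_congr rfl fun S _ => ex_ce _ _
    rw [sum_congr rfl fun K _ => e1 K, ← hsum fun S _ => P.ex (P.lev f ∅ S * P.lev f ∅ S), mul_sum]
    refine sum_congr rfl fun S hS => ?_
    rw [sum_const, nsmul_eq_mul, card_powerset, (mem_powersetCard.1 hS).2]
    norm_num
  have hK : ∑ K ∈ 𝒦, P.ex (P.massAbove f i K * P.massAbove f i K) ≤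
      8 ^ i * M * (∑ S ∈ 𝒮, P.ex (P.lev f ∅ S * P.lev f ∅ S)) + E ^ 17 * e := by
    calc _ ≤ ∑ K ∈ 𝒦, (4 ^ i * M * P.ex (P.massAbove f i K) + E ^ 15 * e) := by
          refine sum_le_sum fun K hK => h.ex_massAbove_sq_le ?_
          obtain ⟨S, hS, hKS⟩ := mem_biUnion.1 hK
          exact (card_le_card (mem_powerset.1 hKS)).trans (mem_powersetCard.1 hS).2.le
      _ = 8 ^ i * M * (∑ S ∈ 𝒮, P.ex (P.lev f ∅ S * P.lev f ∅ S)) + 𝒦.card * (E ^ 15 * e) := by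
          rw [sum_add_distrib, ← mul_sum, hQ, sum_const, nsmul_eq_mul,
            show (8 : ℝ) = 4 * 2 by norm_num, mul_pow]
          ring
      _ ≤ 8 ^ i * M * (∑ S ∈ 𝒮, P.ex (P.lev f ∅ S * P.lev f ∅ S)) + E ^ 2 * (E ^ 15 * e) := by
          gcongr
      _ = _ := by ring
  simp only [sum_add_distrib]
  rw [hmain]
  have hfin : E ^ 10 * e + E ^ 17 * e ≤ E ^ 18 * e := by
    have c1 : E ^ 10 ≤ E ^ 17 := pow_le_pow_right₀ h.one_le (by norm_num)
    have c2 : 2 * E ^ 17 ≤ E * E ^ 17 := by gcongr; exact h.two_le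
    rw [← add_mul]
    gcongr
    linarith
  linarith

/-- Fourth-moment bound for a level of a regular function. -/
theorem ex_level_pow_four_le (h : P.Regular f i γ B M D E) (hBM : B ^ 2 ≤ M) :
    P.ex (P.level f i * P.level f i * (P.level f i * P.level f i)) ≤
      512 ^ i * M * P.ex (P.level f i * P.level f i) + E ^ 26 * (γ * M * D ^ 2) := by
  have hE := h.E0
  have hM := h.M0
  have hγ := h.γ0
  have hE1 := h.one_le
  have herr := h.error_nonneg
  have he : γ * B ^ 2 * D ^ 2 ≤ γ * M * D ^ 2 := by gcongr
  have hpow : ∀ m : ℕ, (2 : ℝ) ^ (i * m) ≤ E ^ m := fun m => by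
    rw [pow_mul]
    exact pow_le_pow_left₀ (by positivity) h.two_pow m
  have h64 : (64 : ℝ) ^ i ≤ E ^ 6 := by
    have := hpow 6
    rwa [mul_comm, pow_mul, show (2 : ℝ) ^ 6 = 64 by norm_num] at this
  have h512 : (512 : ℝ) ^ i ≤ E ^ 9 := by
    have := hpow 9
    rwa [mul_comm, pow_mul, show (2 : ℝ) ^ 9 = 512 by norm_num] at this
  set e := γ * B ^ 2 * D ^ 2
  set e' := γ * M * D ^ 2 with he'
  have hb : ∑ S ∈ powersetCard i univ, P.ex (P.lev f ∅ S * P.lev f ∅ S) ≤ _ :=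
    h.sum_ex_lev_sq_le
  calc _ ≤ E ^ 11 * e + 64 ^ i * (8 ^ i * M * (P.ex (P.level f i * P.level f i) +
          E ^ 7 * γ * D ^ 2) + E ^ 18 * e) := by
        refine h.ex_level_four_le.trans ?_
        gcongr
        refine h.sum_ex_pairMass_sq_le.trans ?_
        gcongr
        refine h.sum_ex_condSq_le.trans ?_
        gcongr
    _ = 512 ^ i * M * P.ex (P.level f i * P.level f i) +
          (E ^ 11 * e + 512 ^ i * (E ^ 7 * e') + 64 ^ i * (E ^ 18 * e)) := by
        rw [show (512 : ℝ) = 64 * 8 by norm_num, mul_pow, he']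
        ring
    _ ≤ 512 ^ i * M * P.ex (P.level f i * P.level f i) +
          (E ^ 11 * e' + E ^ 9 * (E ^ 7 * e') + E ^ 6 * (E ^ 18 * e')) := by
        gcongr
    _ ≤ _ := by
        have he0 : 0 ≤ e' := by positivity
        have c1 : E ^ 11 ≤ E ^ 24 := pow_le_pow_right₀ hE1 (by norm_num)
        have c2 : E ^ 16 ≤ E ^ 24 := pow_le_pow_right₀ hE1 (by norm_num)
        have c3 : (2 * 2) * E ^ 24 ≤ (E * E) * E ^ 24 := by
          have := h.two_le
          gcongr
        have c4 : 0 ≤ E ^ 24 := by positivity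
        have c5 : E ^ 11 + E ^ 16 + E ^ 24 ≤ E ^ 26 := by
          rw [show E ^ 26 = (E * E) * E ^ 24 by ring]
          linarith
        have := mul_le_mul_of_nonneg_right c5 he0
        rw [add_le_add_iff_left]
        calc _ = (E ^ 11 + E ^ 16 + E ^ 24) * e' := by ring
          _ ≤ _ := this

end Regular

end Hypercontractive

end CoordSpace

namespace WSC

section Faces

variable {n d : ℕ} (X : WSC n d)

/-- The weighted sum of `φ` over the `k`-faces containing `s`. -/
noncomputable def upSum (k : ℕ) (s : Finset (Fin n)) (φ : Cf n) : ℝ :=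
  ∑ ρ ∈ X.faces k with s ⊆ ρ, X.w k ρ * φ ρ

variable {X}

lemma mem_faces_of_subset {k : ℕ} (hk : k ≤ d) {s t : Finset (Fin n)} (ht : t ∈ X.faces k)
    (hst : s ⊆ t) : s ∈ X.faces s.card := by
  have htk := X.card_mem k t ht
  induction hm : (t \ s).card generalizing s with
  | zero =>
    have : t ⊆ s := sdiff_eq_empty_iff_subset.1 (card_eq_zero.1 hm)
    rw [subset_antisymm hst this, htk]
    exact ht
  | succ m ih =>
    obtain ⟨u, hu⟩ : (t \ s).Nonempty := card_pos.1 (by omega)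
    have hu' := mem_sdiff.1 hu
    have hlt : s.card < t.card := card_lt_card ⟨hst, fun h => hu'.2 (h hu'.1)⟩
    have h1 : insert u s ∈ X.faces (insert u s).card := by
      refine ih (insert_subset hu'.1 hst) ?_
      rw [sdiff_insert, card_erase_of_mem hu]
      omega
    rw [card_insert_of_notMem hu'.2] at h1
    exact (X.downward _ (by omega) s).2 ⟨rfl, _, h1, subset_insert u s⟩

lemma filter_faces_subset {j k : ℕ} (hk : k ≤ d) {t : Finset (Fin n)} (ht : t ∈ X.faces k) :
    {s ∈ X.faces j | s ⊆ t} = powersetCard j t := by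
  ext s
  rw [mem_filter, mem_powersetCard]
  refine ⟨fun h => ⟨h.2, X.card_mem j s h.1⟩, fun h => ⟨?_, h.1⟩⟩
  rw [← h.2]
  exact mem_faces_of_subset hk ht h.1

lemma sum_upSum {j k : ℕ} (hk : k ≤ d) {s : Finset (Fin n)} (hs : s.card = j)
    (φ : Cf n) : ∑ σ ∈ X.faces (j + 1) with s ⊆ σ, X.upSum k σ φ = ((k : ℝ) - j) * X.upSum k s φ := by
  simp only [upSum]
  rw [sum_comm' (t' := {ρ ∈ X.faces k | s ⊆ ρ})
    (s' := fun ρ => {σ ∈ X.faces (j + 1) | s ⊆ σ ∧ σ ⊆ ρ}), mul_sum]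
  · refine sum_congr rfl fun ρ hρ => ?_
    rw [mem_filter] at hρ
    rw [sum_const, nsmul_eq_mul]
    congr 1
    have e : {σ ∈ X.faces (j + 1) | s ⊆ σ ∧ σ ⊆ ρ} = (ρ \ s).image fun u => insert u s := by
      ext σ
      simp only [mem_filter, mem_image, mem_sdiff]
      constructor
      · rintro ⟨hσ, hsσ, hσρ⟩
        have hc := X.card_mem _ σ hσ
        have h1 : (σ \ s).card = 1 := by
          have := card_sdiff_add_card_eq_card hsσ
          omega
        obtain ⟨u, hu⟩ := card_eq_one.1 h1
        have hu' : u ∈ σ \ s := by rw [hu]; exact mem_singleton_self u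
        rw [mem_sdiff] at hu'
        refine ⟨u, ⟨hσρ hu'.1, hu'.2⟩, ?_⟩
        rw [insert_eq, ← hu, sdiff_union_of_subset hsσ]
      · rintro ⟨u, hu, rfl⟩
        refine ⟨?_, subset_insert u s, insert_subset hu.1 hρ.2⟩
        have := mem_faces_of_subset hk hρ.1 (insert_subset hu.1 hρ.2)
        rwa [card_insert_of_notMem hu.2, hs] at this
    rw [e, card_image_of_injOn, eq_sub_iff_add_eq, ← X.card_mem k ρ hρ.1, ← hs]
    · exact_mod_cast card_sdiff_add_card_eq_card hρ.2
    · intro u hu v _ huv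
      rw [mem_coe, mem_sdiff] at hu
      have huv' : insert u s = insert v s := huv
      have : u ∈ insert v s := huv' ▸ mem_insert_self u s
      exact (mem_insert.1 this).resolve_right hu.2
  · intro σ ρ
    simp only [mem_filter]
    exact ⟨fun h => ⟨⟨h.1.1, h.1.2, h.2.2⟩, h.2.1, h.1.2.trans h.2.2⟩,
      fun h => ⟨⟨h.1.1, h.1.2.1⟩, h.2.1, h.1.2.2⟩⟩

lemma upSum_eq_zero {j k : ℕ} (hk : k ≤ d) {s : Finset (Fin n)} (hs : s.card = j)
    (hsf : s ∉ X.faces j) (φ : Cf n) : X.upSum k s φ = 0 := by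
  refine sum_eq_zero fun ρ hρ => absurd ?_ hsf
  rw [mem_filter] at hρ
  rw [← hs]
  exact mem_faces_of_subset hk hρ.1 hρ.2

lemma upSum_one {j k : ℕ} (hk : k ≤ d) (hj : j ≤ k) {s : Finset (Fin n)} (hs : s.card = j) :
    X.upSum k s 1 = k.choose j * X.w j s := by
  by_cases hsf : s ∈ X.faces j
  swap
  · rw [upSum_eq_zero hk hs hsf, X.w_zero j s hsf, mul_zero]
  induction hm : k - j generalizing j s with
  | zero =>
    obtain rfl : j = k := by omega
    have : {ρ ∈ X.faces j | s ⊆ ρ} = {s} := by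
      ext ρ
      rw [mem_filter, mem_singleton]
      refine ⟨fun h => (eq_of_subset_of_card_le h.2 ?_).symm, ?_⟩
      · rw [X.card_mem j ρ h.1, hs]
      · rintro rfl
        exact ⟨hsf, subset_rfl⟩
    simp [upSum, this]
  | succ m ih =>
    have hjk : j < k := by omega
    have h1 := sum_upSum hk hs (1 : Cf n) (X := X)
    have h2 : ∑ σ ∈ X.faces (j + 1) with s ⊆ σ, X.upSum k σ 1 =
        k.choose (j + 1) * ((j + 1) * X.w j s) := by
      rw [X.w_rec j (by omega) s hsf]
      have : ((j : ℝ) + 1) ≠ 0 := by positivity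
      rw [← mul_assoc ((j : ℝ) + 1), mul_one_div_cancel this, one_mul, mul_sum]
      refine sum_congr rfl fun σ hσ => ?_
      rw [mem_filter] at hσ
      exact ih (by omega) (X.card_mem _ σ hσ.1) hσ.1 (by omega)
    have h3 : (k.choose (j + 1) : ℝ) * (j + 1) = k.choose j * ((k : ℝ) - j) := by
      have := Nat.choose_succ_right_eq k j
      rw [← Nat.cast_sub hjk.le]
      exact_mod_cast this
    have h4 : (0 : ℝ) < (k : ℝ) - j := sub_pos.2 (by exact_mod_cast hjk)
    rw [h2, ← mul_assoc, h3] at h1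
    apply mul_left_cancel₀ h4.ne'
    rw [← h1]
    ring

lemma linkMean_eq (k : ℕ) (s : Finset (Fin n)) (f : Cf n) :
    linkMean X k s f = X.upSum k s f / X.upSum k s 1 := by
  simp [linkMean, upSum]

lemma linkIp_eq (k : ℕ) (s : Finset (Fin n)) (f : Cf n) :
    linkIp X k s f f = linkMean X k s (f * f) := by
  simp [linkMean, linkIp, mul_assoc]

lemma upSum_one_pos {j k : ℕ} (hk : k ≤ d) (hj : j ≤ k) {s : Finset (Fin n)}
    (hs : s ∈ X.faces j) : 0 < X.upSum k s 1 := by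
  rw [upSum_one hk hj (X.card_mem j s hs)]
  exact mul_pos (by exact_mod_cast Nat.choose_pos hj) (X.w_pos j s hs)

lemma Dc_eq_linkMean {k : ℕ} (hk : k ≤ d) (f : Cf n) {m : ℕ} (hm : m ≤ k)
    {s : Finset (Fin n)} (hs : s ∈ X.faces (k - m)) : Dc X k m f s = linkMean X k s f := by
  induction m generalizing s with
  | zero =>
    rw [Nat.sub_zero] at hs
    have : {ρ ∈ X.faces k | s ⊆ ρ} = {s} := by
      ext ρ
      rw [mem_filter, mem_singleton]
      refine ⟨fun h => (eq_of_subset_of_card_le h.2 ?_).symm, ?_⟩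
      · rw [X.card_mem k ρ h.1, X.card_mem k s hs]
      · rintro rfl
        exact ⟨hs, subset_rfl⟩
    have hw := (X.w_pos k s hs).ne'
    simp [Dc, linkMean, this, hw]
  | succ m ih =>
    have hj : k - (m + 1) + 1 = k - m := by omega
    set j := k - (m + 1) with hjd
    have hjk : j < k := by omega
    have hsc := X.card_mem j s hs
    have hch : (0 : ℝ) < k.choose (j + 1) := by exact_mod_cast Nat.choose_pos (by omega)
    have key : ∀ φ : Cf n, (∑ σ ∈ X.faces (j + 1) with s ⊆ σ, X.w (j + 1) σ *
        linkMean X k σ φ) = ((k : ℝ) - j) / k.choose (j + 1) * X.upSum k s φ := by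
      intro φ
      rw [div_mul_eq_mul_div, ← sum_upSum hk hsc, sum_div]
      refine sum_congr rfl fun σ hσ => ?_
      rw [mem_filter] at hσ
      have hw := X.w_pos _ σ hσ.1
      rw [linkMean_eq, upSum_one hk (by omega) (X.card_mem _ σ hσ.1)]
      field_simp
    have hone : ∀ σ ∈ X.faces (j + 1), linkMean X k σ 1 = 1 := by
      intro σ hσ
      rw [linkMean_eq, div_self (upSum_one_pos hk (by omega) hσ).ne']
    have hne : ((k : ℝ) - j) / k.choose (j + 1) ≠ 0 :=
      (div_pos (sub_pos.2 (by exact_mod_cast hjk)) hch).ne'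
    have hnum : ∑ σ ∈ X.faces (j + 1) with s ⊆ σ, X.w (j + 1) σ * Dc X k m f σ =
        ((k : ℝ) - j) / k.choose (j + 1) * X.upSum k s f := by
      rw [← key f]
      refine sum_congr rfl fun σ hσ => ?_
      rw [mem_filter] at hσ
      rw [ih (by omega) (hj ▸ hσ.1)]
    have hden : ∑ σ ∈ X.faces (j + 1) with s ⊆ σ, X.w (j + 1) σ =
        ((k : ℝ) - j) / k.choose (j + 1) * X.upSum k s 1 := by
      rw [← key 1]
      refine sum_congr rfl fun σ hσ => ?_
      rw [hone σ (mem_filter.1 hσ).1, mul_one]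
    rw [Dc, Dop, ← hjd, hnum, hden, mul_div_mul_left _ _ hne, linkMean_eq]

end Faces

end WSC

section Mobius

/-- The alternating sum of `ℓ` over the subsets of `S`. -/
def altSum {α : Type*} [DecidableEq α] (ℓ : Finset α → ℝ) (S : Finset α) : ℝ :=
  ∑ T ∈ S.powerset, (-1 : ℝ) ^ (S \ T).card * ℓ T

lemma altSum_insert {α : Type*} [DecidableEq α] (ℓ : Finset α → ℝ) {a : α} {S : Finset α}
    (ha : a ∉ S) : altSum ℓ (insert a S) = altSum (fun T => ℓ (insert a T)) S - altSum ℓ S := by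
  rw [altSum, sum_powerset_insert ha, altSum, altSum, add_comm, sub_eq_add_neg, ← sum_neg_distrib]
  congr 1 <;> refine sum_congr rfl fun T hT => ?_
  · rw [insert_sdiff_insert, sdiff_insert_of_notMem ha]
  · have haT : a ∉ T := fun h => ha (mem_powerset.1 hT h)
    rw [insert_sdiff_of_notMem _ haT, card_insert_of_notMem (fun h => ha (mem_sdiff.1 h).1)]
    ring

/-- Möbius inversion on the lattice of finite sets. -/
lemma sum_powerset_altSum {α : Type*} [DecidableEq α] (ℓ : Finset α → ℝ) (S : Finset α) :
    ∑ T ∈ S.powerset, altSum ℓ T = ℓ S := by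
  induction S using Finset.induction_on generalizing ℓ with
  | empty => simp [altSum]
  | insert a S ha ih =>
    rw [sum_powerset_insert ha, ← sum_add_distrib, ← ih fun T => ℓ (insert a T)]
    refine sum_congr rfl fun T hT => ?_
    rw [altSum_insert ℓ fun h => ha (mem_powerset.1 hT h)]
    ring

lemma sum_powersetCard_erase {α : Type*} [DecidableEq α] (g : Finset α → ℝ) (T : Finset α)
    (j : ℕ) : ∑ a ∈ T, ∑ σ ∈ powersetCard j (T.erase a), g σ =
      ((T.card - j : ℕ) : ℝ) * ∑ σ ∈ powersetCard j T, g σ := by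
  rw [sum_comm' (t' := powersetCard j T) (s' := fun σ => T \ σ), mul_sum]
  · refine sum_congr rfl fun σ hσ => ?_
    rw [mem_powersetCard] at hσ
    rw [sum_const, nsmul_eq_mul, card_sdiff_of_subset hσ.1, hσ.2]
  · intro a σ
    simp only [mem_powersetCard, mem_sdiff, subset_erase]
    tauto

lemma powersetCard_eq_image_erase {α : Type*} [DecidableEq α] {T : Finset α} {m : ℕ}
    (hT : T.card = m + 1) : powersetCard m T = T.image T.erase := by
  ext σ
  rw [mem_powersetCard, mem_image]
  constructor
  · rintro ⟨hσ, hc⟩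
    have h1 : (T \ σ).card = 1 := by
      have := card_sdiff_add_card_eq_card hσ
      omega
    obtain ⟨u, hu⟩ := card_eq_one.1 h1
    have hu' : u ∈ T \ σ := by rw [hu]; exact mem_singleton_self u
    refine ⟨u, (mem_sdiff.1 hu').1, ?_⟩
    rw [← sdiff_singleton_eq_erase, ← hu, Finset.sdiff_sdiff_eq_self hσ]
  · rintro ⟨a, ha, rfl⟩
    exact ⟨erase_subset a T, by rw [card_erase_of_mem ha, hT]; rfl⟩

end Mobius

namespace WSC

section Levels

variable {n d : ℕ} {X : WSC n d}

lemma choose_mul_Uc (g : Cf n) {j m : ℕ} (hd : j + m ≤ d) {T : Finset (Fin n)}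
    (hT : T ∈ X.faces (j + m)) :
    ((j + m).choose j : ℝ) * Uc X j m g T = ∑ σ ∈ powersetCard j T, g σ := by
  induction m generalizing T with
  | zero =>
    have hc := X.card_mem _ T hT
    rw [add_zero] at hc
    simp [Uc, ← hc]
  | succ m ih =>
    have hc : T.card = j + m + 1 := X.card_mem _ T hT
    have hinj : Set.InjOn T.erase T := erase_injOn T
    have hch : (0 : ℝ) < (j + m).choose j := by
      exact_mod_cast Nat.choose_pos (Nat.le_add_right j m)
    have h1 : ((j + m).choose j : ℝ) * ∑ σ ∈ X.faces (j + m) with σ ⊆ T, Uc X j m g σ =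
        (m + 1 : ℕ) * ∑ σ ∈ powersetCard j T, g σ := by
      rw [filter_faces_subset hd hT, mul_sum]
      rw [sum_congr rfl (g := fun σ => ∑ ρ ∈ powersetCard j σ, g ρ)]
      · rw [powersetCard_eq_image_erase hc, sum_image hinj, sum_powersetCard_erase, hc]
        congr 3
        omega
      · intro σ hσ
        refine ih (by omega) ?_
        rw [← filter_faces_subset hd hT, mem_filter] at hσ
        exact hσ.1
    have h2 : ((j + m + 1).choose j : ℝ) * (m + 1 : ℕ) = (j + m).choose j * ((j + m : ℕ) + 1) := by
      have := Nat.choose_mul_succ_eq (j + m) j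
      rw [show j + m + 1 - j = m + 1 by omega] at this
      exact_mod_cast this.symm
    have h3 : (0 : ℝ) < ((j + m : ℕ) : ℝ) + 1 := by positivity
    have h4 : (0 : ℝ) < ((m + 1 : ℕ) : ℝ) := by positivity
    rw [Uc, Uop, ← add_assoc]
    apply mul_left_cancel₀ h4.ne'
    rw [← h1]
    set s := ∑ σ ∈ X.faces (j + m) with σ ⊆ T, Uc X j m g σ
    calc _ = (((j + m + 1).choose j : ℝ) * (m + 1 : ℕ)) * (1 / (((j + m : ℕ) : ℝ) + 1) * s) := by
          ring
      _ = _ := by rw [h2]; field_simp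

lemma gLevel_eq_altSum {k : ℕ} (hk : k ≤ d) (f : Cf n) {i : ℕ} (hi : i ≤ k)
    {S : Finset (Fin n)} (hS : S ∈ X.faces i) :
    gLevel X k f i S = altSum (fun T => linkMean X k T f) S := by
  induction i using Nat.strong_induction_on generalizing S with
  | _ i ih =>
    have hc := X.card_mem i S hS
    have hterm : ∀ j ∈ range i, (i.choose j : ℝ) * Uc X j (i - j) (gLevel X k f j) S =
        ∑ T ∈ powersetCard j S, altSum (fun T => linkMean X k T f) T := by
      intro j hj
      have hj' := mem_range.1 hj
      have hji : j + (i - j) = i := by omega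
      have := choose_mul_Uc (X := X) (gLevel X k f j) (j := j) (m := i - j) (by omega)
        (T := S) (by rwa [hji])
      rw [hji] at this
      rw [this]
      refine sum_congr rfl fun T hT => ih j hj' (by omega) ?_
      rw [mem_powersetCard] at hT
      rw [← hT.2]
      exact mem_faces_of_subset (hi.trans hk) hS hT.1
    have hsum := sum_powerset_altSum (fun T => linkMean X k T f) S
    rw [sum_powerset, hc, sum_range_succ] at hsum
    have hself : powersetCard i S = {S} := by rw [← hc, powersetCard_self]
    rw [hself, sum_singleton] at hsum
    have hki : k - (k - i) = i := by omega
    rw [gLevel, Pi.sub_apply, Dc_eq_linkMean hk f (Nat.sub_le k i) (hki.symm ▸ hS),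
      Finset.sum_apply, sum_attach (range i)
        (fun j => ((i.choose j : ℝ) • Uc X j (i - j) (gLevel X k f j)) S)]
    simp only [Pi.smul_apply, smul_eq_mul]
    rw [sum_congr rfl hterm]
    linarith

lemma fLevel_eq_sum {k : ℕ} (hk : k ≤ d) (f : Cf n) {i : ℕ} (hi : i ≤ k)
    {τ : Finset (Fin n)} (hτ : τ ∈ X.faces k) :
    fLevel X k f i τ = ∑ S ∈ powersetCard i τ, altSum (fun T => linkMean X k T f) S := by
  have hki : i + (k - i) = k := by omega
  have := choose_mul_Uc (X := X) (gLevel X k f i) (j := i) (m := k - i) (by omega)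
    (T := τ) (hki.symm ▸ hτ)
  rw [hki] at this
  rw [fLevel, Pi.smul_apply, smul_eq_mul, this]
  refine sum_congr rfl fun S hS => gLevel_eq_altSum hk f hi ?_
  rw [mem_powersetCard] at hS
  rw [← hS.2]
  exact mem_faces_of_subset hk hτ hS.1

end Levels

end WSC

namespace WSC

section OrderedFaces

variable {n d : ℕ}

/-- The orderings of the `k`-faces. -/
abbrev Ord (X : WSC n d) (k : ℕ) := {x : Fin k → Fin n // univ.image x ∈ X.faces k}

variable (X : WSC n d) (k : ℕ)

/-- A `k`-face drawn from `π_k` and ordered uniformly at random. -/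
noncomputable def ordSpace : CoordSpace (X.Ord k) (Fin k) (Fin n) where
  μ x := X.w k (univ.image x.1) / k.factorial
  pos x := div_pos (X.w_pos k _ x.2) (by positivity)
  x := Subtype.val

variable {X k}

/-- A function on `k`-faces as a function of their orderings. -/
def onOrd (φ : Cf n) : X.Ord k → ℝ := fun x => φ (univ.image x.1)

lemma Ord.injective (x : X.Ord k) : Function.Injective x.1 := by
  rw [← Set.injOn_univ, ← coe_univ, ← card_image_iff, X.card_mem k _ x.2, card_univ,
    Fintype.card_fin]

lemma card_orderings (τ : Finset (Fin n)) (hτ : τ.card = k) (A : Finset (Fin k))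
    (z : Fin k → Fin n) (hz : Set.InjOn z A) (hzA : A.image z ⊆ τ) :
    ({y : Fin k → Fin n | univ.image y = τ ∧ ∀ a ∈ A, y a = z a} : Finset _).card =
      (k - A.card).factorial := by
  induction hm : k - A.card generalizing A z with
  | zero =>
    have hA : A = univ := by
      rw [← card_eq_iff_eq_univ, Fintype.card_fin]
      have := card_le_univ A
      rw [Fintype.card_fin] at this
      omega
    subst hA
    rw [Nat.factorial_zero, card_eq_one]
    refine ⟨z, ?_⟩
    ext y
    simp only [mem_filter, mem_univ, true_and, mem_singleton, forall_const]
    refine ⟨fun h => funext h.2, ?_⟩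
    rintro rfl
    refine ⟨eq_of_subset_of_card_le hzA ?_, fun _ => rfl⟩
    rw [card_image_of_injOn hz, hτ, card_univ, Fintype.card_fin]
  | succ m ih =>
    have hAk : A.card < k := by omega
    obtain ⟨a, ha⟩ : ∃ a, a ∉ A := by
      by_contra! hcon
      have : A = univ := eq_univ_of_forall hcon
      rw [this, card_univ, Fintype.card_fin] at hAk
      exact lt_irrefl _ hAk
    have hyinj : ∀ y : Fin k → Fin n, univ.image y = τ → Function.Injective y := by
      intro y hy
      rw [← Set.injOn_univ, ← coe_univ, ← card_image_iff, hy, hτ, card_univ, Fintype.card_fin]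
    rw [card_eq_sum_card_fiberwise (f := fun y => y a) (t := τ \ A.image z)]
    · rw [sum_const_nat (m := m.factorial)]
      · rw [card_sdiff_of_subset hzA, card_image_of_injOn hz, hτ, hm, Nat.factorial_succ]
      · intro u hu
        rw [mem_sdiff] at hu
        have hupd : ∀ b ∈ A, Function.update z a u b = z b := fun b hb =>
          Function.update_of_ne (ne_of_mem_of_not_mem hb ha) _ _
        have himg : A.image (Function.update z a u) = A.image z := image_congr hupd
        rw [← ih (insert a A) (Function.update z a u) ?_ ?_ ?_]
        · congr 1
          ext y
          simp only [mem_filter, mem_univ, true_and, forall_mem_insert, Function.update_self]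
          constructor
          · rintro ⟨⟨h1, h2⟩, h3⟩
            exact ⟨h1, h3, fun b hb => (h2 b hb).trans (hupd b hb).symm⟩
          · rintro ⟨h1, h3, h2⟩
            exact ⟨⟨h1, fun b hb => (h2 b hb).trans (hupd b hb)⟩, h3⟩
        · rw [coe_insert, Set.injOn_insert (by simpa using ha)]
          refine ⟨fun b hb c hc hbc => hz hb hc ?_, ?_⟩
          · rwa [hupd b hb, hupd c hc] at hbc
          · rw [Function.update_self, ← coe_image, himg]
            exact hu.2
        · rw [image_insert, Function.update_self, himg]
          exact insert_subset hu.1 hzA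
        · rw [card_insert_of_notMem ha]
          omega
    · intro y hy
      simp only [coe_filter, mem_univ, true_and, Set.mem_ofPred_eq] at hy
      rw [mem_coe, mem_sdiff]
      refine ⟨hy.1 ▸ mem_image_of_mem y (mem_univ a), fun h => ?_⟩
      obtain ⟨b, hb, hba⟩ := mem_image.1 h
      rw [← hy.2 b hb] at hba
      exact ha (hyinj y hy.1 hba ▸ hb)

lemma sum_ordSpace (A : Finset (Fin k)) (z : Fin k → Fin n) (hz : Set.InjOn z A) (φ : Cf n) :
    ∑ y : X.Ord k with ∀ a ∈ A, y.1 a = z a, (X.ordSpace k).μ y * onOrd φ y =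
      (k - A.card).factorial / k.factorial * X.upSum k (A.image z) φ := by
  have hmaps : ∀ y ∈ ({y : X.Ord k | ∀ a ∈ A, y.1 a = z a} : Finset _),
      univ.image y.1 ∈ {ρ ∈ X.faces k | A.image z ⊆ ρ} := by
    intro y hy
    rw [mem_filter] at hy ⊢
    refine ⟨y.2, image_subset_iff.2 fun a ha => ?_⟩
    rw [← hy.2 a ha]
    exact mem_image_of_mem _ (mem_univ a)
  rw [← sum_fiberwise_of_maps_to hmaps, upSum, mul_sum]
  refine sum_congr rfl fun ρ hρ => ?_
  rw [mem_filter] at hρ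
  rw [sum_congr rfl (g := fun _ => X.w k ρ / k.factorial * φ ρ), sum_const, nsmul_eq_mul,
    ← card_orderings ρ (X.card_mem k ρ hρ.1) A z hz hρ.2]
  · rw [show ({y ∈ ({y : X.Ord k | ∀ a ∈ A, y.1 a = z a} : Finset _) |
        univ.image y.1 = ρ}).card =
        ({y : Fin k → Fin n | univ.image y = ρ ∧ ∀ a ∈ A, y a = z a} : Finset _).card from ?_]
    · ring
    · refine card_nbij Subtype.val ?_ Subtype.val_injective.injOn ?_
      · intro y hy
        simp only [mem_coe, mem_filter, mem_univ, true_and] at hy ⊢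
        exact ⟨hy.2, hy.1⟩
      · intro y hy
        simp only [coe_filter, mem_univ, true_and, Set.mem_ofPred_eq] at hy
        refine ⟨⟨y, hy.1 ▸ hρ.1⟩, ?_, rfl⟩
        simp only [coe_filter, mem_univ, true_and, Set.mem_ofPred_eq, mem_filter]
        exact ⟨hy.2, hy.1⟩
  · intro y hy
    simp only [mem_filter, mem_univ, true_and] at hy
    simp only [ordSpace, onOrd, hy.2]

lemma sum_cls (A : Finset (Fin k)) (x : X.Ord k) (φ : Cf n) :
    ∑ y ∈ (X.ordSpace k).cls A x, (X.ordSpace k).μ y * onOrd φ y =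
      (k - A.card).factorial / k.factorial * X.upSum k (A.image x.1) φ := by
  rw [← sum_ordSpace A x.1 x.injective.injOn φ]
  refine sum_congr ?_ fun _ _ => rfl
  ext y
  rw [CoordSpace.mem_cls, mem_filter]
  simp [ordSpace]

lemma ce_onOrd (A : Finset (Fin k)) (x : X.Ord k) (φ : Cf n) :
    (X.ordSpace k).ce A (onOrd φ) x = linkMean X k (A.image x.1) φ := by
  have h1 : ∑ y ∈ (X.ordSpace k).cls A x, (X.ordSpace k).μ y =
      (k - A.card).factorial / k.factorial * X.upSum k (A.image x.1) 1 := by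
    rw [← sum_cls]
    simp [onOrd]
  rw [CoordSpace.ce_apply, sum_cls, h1, linkMean_eq, mul_div_mul_left]
  positivity

lemma exists_ord {τ : Finset (Fin n)} (hτ : τ ∈ X.faces k) :
    ∃ x : X.Ord k, univ.image x.1 = τ := by
  have h : univ.image (τ.orderEmbOfFin (X.card_mem k τ hτ)) = τ := image_orderEmbOfFin_univ _ _
  exact ⟨⟨_, h.symm ▸ hτ⟩, h⟩

lemma ex_onOrd (φ : Cf n) : (X.ordSpace k).ex (onOrd φ) = EE X k φ := by
  rw [CoordSpace.ex_apply, EE]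
  rcases isEmpty_or_nonempty (X.Ord k) with h | ⟨⟨x⟩⟩
  · have : X.faces k = ∅ := eq_empty_of_forall_notMem fun τ hτ =>
      h.elim (exists_ord hτ).choose
    simp [this]
  · have := sum_ordSpace (X := X) ∅ x.1 (by simp) φ
    simpa [upSum, Nat.factorial_ne_zero] using this

lemma level_onOrd (hk : k ≤ d) (f : Cf n) {i : ℕ} (hi : i ≤ k) :
    (X.ordSpace k).level (onOrd f) i = onOrd (fLevel X k f i) := by
  ext x
  have hmap : univ.image x.1 = univ.map ⟨x.1, x.injective⟩ := by rw [map_eq_image]; rfl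
  rw [onOrd, fLevel_eq_sum hk f hi x.2, CoordSpace.level, Finset.sum_apply, hmap,
    powersetCard_map, sum_map]
  refine sum_congr rfl fun A _ => ?_
  rw [CoordSpace.lev, Finset.sum_apply, altSum, RelEmbedding.coe_toEmbedding,
    mapEmbedding_apply, map_eq_image, Function.Embedding.coeFn_mk, powerset_image,
    sum_image (image_injective x.injective).injOn]
  refine sum_congr rfl fun T _ => ?_
  rw [Pi.smul_apply, smul_eq_mul, empty_union, ce_onOrd, ← image_sdiff _ _ x.injective,
    card_image_of_injective _ x.injective]

end OrderedFaces

end WSC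

namespace WSC

section Symmetry

variable {n d : ℕ} {X : WSC n d} {k : ℕ}

lemma ex_comp_perm (σ : Equiv.Perm (Fin k)) (ψ : (Fin k → Fin n) → ℝ) :
    (X.ordSpace k).ex (fun x => ψ (x.1 ∘ σ)) = (X.ordSpace k).ex (fun x => ψ x.1) := by
  have himg : ∀ (ρ : Equiv.Perm (Fin k)) (x : Fin k → Fin n),
      univ.image (x ∘ ρ) = univ.image x := by
    intro ρ x
    rw [← image_image, image_univ_equiv]
  rw [CoordSpace.ex_apply, CoordSpace.ex_apply]
  refine sum_nbij' (fun x => ⟨x.1 ∘ σ, (himg σ x.1).symm ▸ x.2⟩)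
    (fun x => ⟨x.1 ∘ σ.symm, (himg σ.symm x.1).symm ▸ x.2⟩) (by simp) (by simp) ?_ ?_ ?_
  · intro x _
    ext a
    simp
  · intro x _
    ext a
    simp
  · intro x _
    simp only [ordSpace, himg]

lemma ex_image_congr {A B : Finset (Fin k)} (h : A.card = B.card) (ψ : Cf n) :
    (X.ordSpace k).ex (fun x => ψ (A.image x.1)) =
      (X.ordSpace k).ex (fun x => ψ (B.image x.1)) := by
  let e : {a // a ∈ A} ≃ {b // b ∈ B} := equivOfCardEq h
  have hσ : A.image e.extendSubtype = B := by
    refine eq_of_subset_of_card_le (image_subset_iff.2 fun a ha => e.extendSubtype_mem a ha) ?_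
    rw [card_image_of_injective _ e.extendSubtype.injective, h]
  rw [← ex_comp_perm e.extendSubtype fun y => ψ (A.image y)]
  simp only [← image_image, hσ]

/-- The coordinates in `A` of a random ordered `k`-face span a random `|A|`-face. -/
lemma ex_image (hk : k ≤ d) (A : Finset (Fin k)) (ψ : Cf n) :
    (X.ordSpace k).ex (fun x => ψ (A.image x.1)) = EE X A.card ψ := by
  have hAk : A.card ≤ k := by simpa using card_le_univ A
  have hc : (0 : ℝ) < k.choose A.card := by exact_mod_cast Nat.choose_pos hAk
  have h1 : k.choose A.card * (X.ordSpace k).ex (fun x => ψ (A.image x.1)) =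
      ∑ B ∈ powersetCard A.card univ, (X.ordSpace k).ex (fun x => ψ (B.image x.1)) := by
    rw [sum_congr rfl fun B hB => ex_image_congr (mem_powersetCard.1 hB).2 ψ, sum_const,
      card_powersetCard, card_univ, Fintype.card_fin, nsmul_eq_mul]
  have h2 : ∑ B ∈ powersetCard A.card univ, (X.ordSpace k).ex (fun x => ψ (B.image x.1)) =
      (X.ordSpace k).ex (onOrd fun τ => ∑ s ∈ powersetCard A.card τ, ψ s) := by
    rw [← map_sum]
    congr 1
    ext x
    have hmap : univ.image x.1 = univ.map ⟨x.1, x.injective⟩ := by rw [map_eq_image]; rfl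
    rw [Finset.sum_apply, onOrd, hmap, powersetCard_map, sum_map]
    refine sum_congr rfl fun B _ => ?_
    rw [RelEmbedding.coe_toEmbedding, mapEmbedding_apply, map_eq_image]
    rfl
  have h3 : EE X k (fun τ => ∑ s ∈ powersetCard A.card τ, ψ s) =
      k.choose A.card * EE X A.card ψ := by
    rw [EE, EE, mul_sum]
    simp only [mul_sum]
    rw [sum_comm' (t' := X.faces A.card) (s' := fun s => {τ ∈ X.faces k | s ⊆ τ})]
    · refine sum_congr rfl fun s hs => ?_
      rw [← mul_assoc, ← upSum_one hk hAk (X.card_mem _ s hs), upSum, sum_mul]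
      simp
    · intro τ s
      rw [mem_filter]
      constructor
      · rintro ⟨h, h'⟩
        rw [← filter_faces_subset hk h, mem_filter] at h'
        exact ⟨⟨h, h'.2⟩, h'.1⟩
      · rintro ⟨⟨h, h'⟩, h''⟩
        rw [← filter_faces_subset hk h, mem_filter]
        exact ⟨h, h'', h'⟩
  rw [h2, ex_onOrd, h3] at h1
  exact mul_left_cancel₀ hc.ne' h1

lemma ex_ce_mul_ce (hk : k ≤ d) (f : Cf n) {A : Finset (Fin k)} {i : ℕ} (hA : A.card = i) :
    (X.ordSpace k).ex ((X.ordSpace k).ce A (onOrd f) * (X.ordSpace k).ce A (onOrd f)) =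
      ip X i (Dc X k (k - i) f) (Dc X k (k - i) f) := by
  subst hA
  have hAk : A.card ≤ k := by simpa using card_le_univ A
  have h : (X.ordSpace k).ce A (onOrd f) * (X.ordSpace k).ce A (onOrd f) =
      fun x => (fun s => linkMean X k s f * linkMean X k s f) (A.image x.1) := by
    ext x
    rw [Pi.mul_apply, ce_onOrd]
  rw [h]
  refine (ex_image hk A fun s => linkMean X k s f * linkMean X k s f).trans ?_
  rw [EE, ip]
  refine sum_congr rfl fun s hs => ?_
  rw [Dc_eq_linkMean hk f (Nat.sub_le _ _) (by rwa [Nat.sub_sub_self hAk]), mul_assoc]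

end Symmetry

end WSC

namespace CoordSpace

section Centering

variable {Ω ι V : Type*} [Fintype Ω] {P : CoordSpace Ω ι V}

lemma ce_sub_ce (C : Finset ι) (φ : Ω → ℝ) : P.ce C (φ - P.ce C φ) = 0 := by
  rw [map_sub, ce_eq_self (meas_ce C φ), sub_self]

lemma ex_sub_ce_mul_sub_ce (C : Finset ι) (φ ψ : Ω → ℝ) :
    P.ex ((φ - P.ce C φ) * (ψ - P.ce C ψ)) = P.ex (φ * ψ) - P.ex (P.ce C φ * P.ce C ψ) := by
  have h1 := ex_mul_ce (meas_ce (P := P) C φ) ψ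
  have h2 := ex_mul_ce (meas_ce (P := P) C ψ) φ
  rw [mul_comm, mul_comm (P.ce C ψ)] at h2
  rw [sub_mul, mul_sub, mul_sub, map_sub, map_sub, map_sub]
  linarith

lemma nrm_sub_ce_le (C : Finset ι) (φ : Ω → ℝ) : P.nrm (φ - P.ce C φ) ≤ P.nrm φ := by
  refine nrm_le (nrm_nonneg φ) ?_
  rw [ex_sub_ce_mul_sub_ce, nrm_sq]
  linarith [ex_mul_self_nonneg (P := P) (P.ce C φ)]

/-- It suffices to check near independence conditionally, for centered functions, and with the
arithmetic mean of the second moments. -/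
lemma isProd_of_centered [DecidableEq ι] {γ : ℝ} (hγ : 0 ≤ γ)
    (h : ∀ (C : Finset ι) (a b : ι), a ∉ C → b ∉ C → a ≠ b → ∀ φ ψ : Ω → ℝ,
      P.Meas (insert a C) φ → P.Meas (insert b C) ψ → P.ce C φ = 0 → P.ce C ψ = 0 →
      ∀ ω, |P.ce C (φ * ψ) ω| ≤ γ / 2 * (P.ce C (φ * φ) ω + P.ce C (ψ * ψ) ω)) :
    P.IsProd γ := by
  intro C a b ha hb hab φ ψ hφ hψ
  have key : ∀ φ ψ : Ω → ℝ, P.Meas (insert a C) φ → P.Meas (insert b C) ψ → P.ce C φ = 0 →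
      P.ce C ψ = 0 → P.ex (φ * ψ) ≤ γ / 2 * (P.nrm φ ^ 2 + P.nrm ψ ^ 2) := by
    intro φ ψ hφ hψ hφ0 hψ0
    have hsmul : γ / 2 * (P.nrm φ ^ 2 + P.nrm ψ ^ 2) =
        P.ex ((γ / 2) • (P.ce C (φ * φ) + P.ce C (ψ * ψ))) := by
      rw [map_smul, map_add, ex_ce, ex_ce, nrm_sq, nrm_sq, smul_eq_mul]
    rw [hsmul, ← ex_ce C (φ * ψ)]
    exact ex_mono fun ω => (le_abs_self _).trans (h C a b ha hb hab φ ψ hφ hψ hφ0 hψ0 ω)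
  have key' : ∀ φ ψ : Ω → ℝ, P.Meas (insert a C) φ → P.Meas (insert b C) ψ → P.ce C φ = 0 →
      P.ce C ψ = 0 → P.ex (φ * ψ) ≤ γ * P.nrm φ * P.nrm ψ := by
    intro φ ψ hφ hψ hφ0 hψ0
    rcases (mul_nonneg (nrm_nonneg (P := P) φ) (nrm_nonneg (P := P) ψ)).eq_or_lt with h0 | h0
    · have := (le_abs_self _).trans (abs_ex_mul_le (P := P) φ ψ)
      rw [mul_assoc, ← h0] at *
      simpa using this
    · have := key (P.nrm ψ • φ) (P.nrm φ • ψ) (hφ.smul _) (hψ.smul _) (by rw [map_smul, hφ0, smul_zero])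
        (by rw [map_smul, hψ0, smul_zero])
      rw [smul_mul_smul_comm, map_smul, smul_eq_mul, nrm_smul, nrm_smul, abs_of_nonneg (nrm_nonneg _),
        abs_of_nonneg (nrm_nonneg _)] at this
      refine le_of_mul_le_mul_left ?_ h0
      linarith
  have hle : γ * P.nrm (φ - P.ce C φ) * P.nrm (ψ - P.ce C ψ) ≤ γ * P.nrm φ * P.nrm ψ := by
    have := nrm_nonneg (P := P) φ
    have := nrm_nonneg (P := P) (ψ - P.ce C ψ)
    have := nrm_sub_ce_le (P := P) C φ
    have := nrm_sub_ce_le (P := P) C ψ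
    gcongr
  have hφ' := hφ.sub ((meas_ce C φ).mono (subset_insert a C))
  have hψ' := hψ.sub ((meas_ce C ψ).mono (subset_insert b C))
  rw [← ex_sub_ce_mul_sub_ce, abs_le']
  refine ⟨(key' _ _ hφ' hψ' (ce_sub_ce _ _) (ce_sub_ce _ _)).trans hle, ?_⟩
  have := key' _ _ (hφ'.smul (-1)) hψ' (by rw [map_smul, ce_sub_ce, smul_zero]) (ce_sub_ce _ _)
  rw [nrm_smul, smul_mul_assoc, map_smul, abs_neg, abs_one, one_mul, neg_one_smul] at this
  exact this.trans hle

end Centering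

end CoordSpace

namespace WSC

section Expansion

variable {n d : ℕ} {X : WSC n d} {k : ℕ}

lemma sum_μ_pair (hk : k ≤ d) {C : Finset (Fin k)} {a b : Fin k} (ha : a ∉ C) (hb : b ∉ C)
    (hab : a ≠ b) (x : X.Ord k) (u v : Fin n) :
    ∑ y ∈ (X.ordSpace k).cls C x with y.1 a = u ∧ y.1 b = v, (X.ordSpace k).μ y =
      ((C.card + 2).factorial : ℝ)⁻¹ * edgeW X C.card (C.image x.1) u v := by
  by_cases huv : u ≠ v ∧ u ∉ C.image x.1 ∧ v ∉ C.image x.1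
  · obtain ⟨h1, h2, h3⟩ := huv
    have ha' : a ∉ insert b C := by simp [hab, ha]
    have hcard : (insert a (insert b C)).card = C.card + 2 := by
      rw [card_insert_of_notMem ha', card_insert_of_notMem hb]
    have hjk : C.card + 2 ≤ k := by
      rw [← hcard]
      simpa using card_le_univ (insert a (insert b C))
    let z := Function.update (Function.update x.1 a u) b v
    have hza : z a = u := by simp [z, hab]
    have hzb : z b = v := by simp [z]
    have hzC : ∀ c ∈ C, z c = x.1 c := by
      intro c hc
      simp [z, ne_of_mem_of_not_mem hc ha, ne_of_mem_of_not_mem hc hb]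
    have hzimg : C.image z = C.image x.1 := image_congr hzC
    have hz : Set.InjOn z (insert a (insert b C) : Finset (Fin k)) := by
      rw [coe_insert, Set.injOn_insert (by exact_mod_cast ha'), coe_insert,
        Set.injOn_insert (by exact_mod_cast hb), ← coe_insert, ← coe_image, ← coe_image,
        image_insert, hzimg, hza, hzb]
      refine ⟨⟨fun c hc c' hc' h => x.injective ?_, by exact_mod_cast h3⟩, ?_⟩
      · rwa [hzC c hc, hzC c' hc'] at h
      · rw [mem_coe, mem_insert]
        tauto
    have hsum := sum_ordSpace (X := X) _ z hz 1
    have hcard' : (insert u (insert v (C.image x.1))).card = C.card + 2 := by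
      rw [card_insert_of_notMem (by simp only [mem_insert]; tauto), card_insert_of_notMem h3,
        card_image_of_injective _ x.injective]
    rw [image_insert, image_insert, hzimg, hza, hzb, upSum_one hk hjk hcard', hcard] at hsum
    have hE : edgeW X C.card (C.image x.1) u v =
        X.w (C.card + 2) (insert u (insert v (C.image x.1))) := by
      rw [edgeW]
      split_ifs with h
      · rfl
      · rw [X.w_zero]
        tauto
    rw [hE]
    have hfac := Nat.choose_mul_factorial_mul_factorial hjk
    have hk0 : (k.factorial : ℝ) ≠ 0 := by positivity
    have hj0 : ((C.card + 2).factorial : ℝ) ≠ 0 := by positivity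
    have hcoef : ((k - (C.card + 2)).factorial : ℝ) / k.factorial * k.choose (C.card + 2) =
        ((C.card + 2).factorial : ℝ)⁻¹ := by
      rw [← hfac]
      push_cast
      have : ((k - (C.card + 2)).factorial : ℝ) ≠ 0 := by positivity
      have : (k.choose (C.card + 2) : ℝ) ≠ 0 := by
        exact_mod_cast (Nat.choose_pos hjk).ne'
      field_simp
    rw [← mul_assoc, hcoef] at hsum
    rw [← hsum]
    refine sum_congr ?_ fun y _ => by simp [onOrd]
    ext y
    rw [mem_filter, CoordSpace.mem_cls, mem_filter]
    simp only [mem_univ, true_and, forall_mem_insert, hza, hzb]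
    have : (∀ c ∈ C, y.1 c = z c) ↔ ∀ c ∈ C, y.1 c = x.1 c :=
      forall₂_congr fun c hc => by rw [hzC c hc]
    rw [this]
    simp only [ordSpace]
    tauto
  · rw [edgeW, if_neg (by tauto), mul_zero, filter_eq_empty_iff.2, sum_empty]
    rintro y hy ⟨rfl, rfl⟩
    refine huv ⟨y.injective.ne hab, ?_, ?_⟩ <;> intro h <;> obtain ⟨c, hc, hcy⟩ := mem_image.1 h
    · rw [← show y.1 c = x.1 c from CoordSpace.mem_cls.1 hy c hc] at hcy
      exact ha (y.injective hcy ▸ hc)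
    · rw [← show y.1 c = x.1 c from CoordSpace.mem_cls.1 hy c hc] at hcy
      exact hb (y.injective hcy ▸ hc)

/-- Conditioned on the coordinates in `C`, two further coordinates are distributed as a random
edge of the link. -/
lemma sum_cls_pair (hk : k ≤ d) {C : Finset (Fin k)} {a b : Fin k} (ha : a ∉ C) (hb : b ∉ C)
    (hab : a ≠ b) (x : X.Ord k) (F H : Fin n → ℝ) :
    ∑ y ∈ (X.ordSpace k).cls C x, (X.ordSpace k).μ y * (F (y.1 a) * H (y.1 b)) =
      ((C.card + 2).factorial : ℝ)⁻¹ *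
        ∑ u, ∑ v, edgeW X C.card (C.image x.1) u v * F u * H v := by
  rw [← sum_fiberwise (g := fun y => (y.1 a, y.1 b)), Fintype.sum_prod_type, mul_sum]
  refine sum_congr rfl fun u _ => ?_
  rw [mul_sum]
  refine sum_congr rfl fun v _ => ?_
  rw [mul_assoc, ← mul_assoc, ← sum_μ_pair hk ha hb hab x u v, sum_mul]
  refine sum_congr ?_ fun y hy => ?_
  · simp only [Prod.mk.injEq]
  · rw [mem_filter] at hy
    rw [hy.2.1, hy.2.2]

lemma sum_cls_single (hk : k ≤ d) {C : Finset (Fin k)} {a b : Fin k} (ha : a ∉ C) (hb : b ∉ C)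
    (hab : a ≠ b) (x : X.Ord k) (F : Fin n → ℝ) :
    ∑ y ∈ (X.ordSpace k).cls C x, (X.ordSpace k).μ y * F (y.1 a) =
      ((C.card + 2).factorial : ℝ)⁻¹ * ∑ u, vertW X C.card (C.image x.1) u * F u := by
  have h := sum_cls_pair hk ha hb hab x F 1
  simp only [Pi.one_apply, mul_one, ← sum_mul] at h
  exact h

lemma exists_eq_coord {C : Finset (Fin k)} {a : Fin k} {φ : X.Ord k → ℝ}
    (hφ : (X.ordSpace k).Meas (insert a C) φ) (x : X.Ord k) :
    ∃ F : Fin n → ℝ, ∀ y ∈ (X.ordSpace k).cls C x, φ y = F (y.1 a) := by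
  classical
  refine ⟨fun u => if h : ∃ y ∈ (X.ordSpace k).cls C x, y.1 a = u then φ h.choose else 0, ?_⟩
  intro y hy
  have h : ∃ y' ∈ (X.ordSpace k).cls C x, y'.1 a = y.1 a := ⟨y, hy, rfl⟩
  simp only [dif_pos h]
  refine hφ _ _ fun c hc => ?_
  rcases mem_insert.1 hc with rfl | hc
  · exact h.choose_spec.2.symm
  · rw [CoordSpace.mem_cls.1 hy c hc, CoordSpace.mem_cls.1 h.choose_spec.1 c hc]

/-- The polarized form of the expansion of a link. -/
lemma abs_edge_form_le {γ : ℝ} (hX : IsLSE X γ) {j : ℕ} (hj : j + 2 ≤ d) {s : Finset (Fin n)}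
    (hs : s ∈ X.faces j) {F H : Fin n → ℝ} (hF : ∑ u, vertW X j s u * F u = 0)
    (hH : ∑ u, vertW X j s u * H u = 0)
    (hsymm : ∑ u, ∑ v, edgeW X j s u v * F u * H v = ∑ u, ∑ v, edgeW X j s u v * H u * F v) :
    |∑ u, ∑ v, edgeW X j s u v * F u * H v| ≤
      γ / 2 * (∑ u, vertW X j s u * F u ^ 2 + ∑ u, vertW X j s u * H u ^ 2) := by
  have h1 := hX j hj s hs (F + H) (by simp [mul_add, sum_add_distrib, hF, hH])
  have h2 := hX j hj s hs (F - H) (by simp [mul_sub, sum_sub_distrib, hF, hH])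
  have e1 : ∑ u, ∑ v, edgeW X j s u v * (F + H) u * (F + H) v =
      ∑ u, ∑ v, edgeW X j s u v * F u * F v + ∑ u, ∑ v, edgeW X j s u v * H u * H v +
      2 * ∑ u, ∑ v, edgeW X j s u v * F u * H v := by
    rw [two_mul]
    nth_rewrite 2 [hsymm]
    simp only [← sum_add_distrib, Pi.add_apply]
    exact sum_congr rfl fun u _ => sum_congr rfl fun v _ => by ring
  have e2 : ∑ u, ∑ v, edgeW X j s u v * (F - H) u * (F - H) v =
      ∑ u, ∑ v, edgeW X j s u v * F u * F v + ∑ u, ∑ v, edgeW X j s u v * H u * H v -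
      2 * ∑ u, ∑ v, edgeW X j s u v * F u * H v := by
    rw [two_mul]
    nth_rewrite 2 [hsymm]
    simp only [← sum_add_distrib, ← sum_sub_distrib, Pi.sub_apply]
    exact sum_congr rfl fun u _ => sum_congr rfl fun v _ => by ring
  have e3 : ∑ u, vertW X j s u * (F + H) u ^ 2 + ∑ u, vertW X j s u * (F - H) u ^ 2 =
      2 * (∑ u, vertW X j s u * F u ^ 2 + ∑ u, vertW X j s u * H u ^ 2) := by
    simp only [← sum_add_distrib, mul_sum, Pi.add_apply, Pi.sub_apply]
    exact sum_congr rfl fun u _ => by ring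
  rw [e1] at h1
  rw [e2] at h2
  have h3 : γ * ∑ u, vertW X j s u * (F + H) u ^ 2 + γ * ∑ u, vertW X j s u * (F - H) u ^ 2 =
      2 * (γ * (∑ u, vertW X j s u * F u ^ 2 + ∑ u, vertW X j s u * H u ^ 2)) := by
    rw [← mul_add, e3]
    ring
  rw [abs_le] at h1 h2 ⊢
  constructor <;> linarith [h1.1, h1.2, h2.1, h2.2]

lemma isProd_ordSpace {γ : ℝ} (hγ : 0 ≤ γ) (hX : IsLSE X γ) (hk : k ≤ d) :
    (X.ordSpace k).IsProd γ := by
  refine CoordSpace.isProd_of_centered hγ fun C a b ha hb hab φ ψ hφ hψ hφ0 hψ0 x => ?_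
  obtain ⟨F, hF⟩ := exists_eq_coord hφ x
  obtain ⟨H, hH⟩ := exists_eq_coord hψ x
  have hcard : C.card + 2 ≤ k := by
    have : (insert a (insert b C)).card = C.card + 2 := by
      rw [card_insert_of_notMem (by simp [hab, ha]), card_insert_of_notMem hb]
    rw [← this]
    simpa using card_le_univ (insert a (insert b C))
  have hs : C.image x.1 ∈ X.faces C.card := by
    rw [← card_image_of_injective C x.injective]
    exact mem_faces_of_subset hk x.2 (image_subset_image (subset_univ C))
  have hκ : 0 < ((C.card + 2).factorial : ℝ)⁻¹ := by positivity
  have hm := CoordSpace.mass_pos (P := X.ordSpace k) C x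
  have hmean : ∀ (θ : X.Ord k → ℝ) (c e : Fin k) (G : Fin n → ℝ), c ∉ C → e ∉ C → c ≠ e →
      (∀ y ∈ (X.ordSpace k).cls C x, θ y = G (y.1 c)) → (X.ordSpace k).ce C θ = 0 →
      ∑ u, vertW X C.card (C.image x.1) u * G u = 0 := by
    intro θ c e G hc he hce hG h
    have h := congrFun h x
    rw [CoordSpace.ce_apply, Pi.zero_apply, div_eq_zero_iff, or_iff_left hm.ne',
      sum_congr rfl fun y hy => by rw [hG y hy], sum_cls_single hk hc he hce] at h
    exact (mul_eq_zero.1 h).resolve_left hκ.ne'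
  have hsq : ∀ (θ : X.Ord k → ℝ) (c e : Fin k) (G : Fin n → ℝ), c ∉ C → e ∉ C → c ≠ e →
      (∀ y ∈ (X.ordSpace k).cls C x, θ y = G (y.1 c)) →
      ∑ y ∈ (X.ordSpace k).cls C x, (X.ordSpace k).μ y * (θ * θ) y =
        ((C.card + 2).factorial : ℝ)⁻¹ * ∑ u, vertW X C.card (C.image x.1) u * G u ^ 2 := by
    intro θ c e G hc he hce hG
    rw [← sum_cls_single hk hc he hce x fun u => G u ^ 2]
    exact sum_congr rfl fun y hy => by rw [Pi.mul_apply, hG y hy, sq]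
  have hFH := sum_cls_pair hk ha hb hab x F H
  have hHF := sum_cls_pair hk hb ha hab.symm x H F
  have hsymm : ∑ u, ∑ v, edgeW X C.card (C.image x.1) u v * F u * H v =
      ∑ u, ∑ v, edgeW X C.card (C.image x.1) u v * H u * F v := by
    refine mul_left_cancel₀ hκ.ne' ?_
    rw [← hFH, ← hHF]
    exact sum_congr rfl fun y _ => by ring
  have hmain := abs_edge_form_le hX (hcard.trans hk) hs (hmean φ a b F ha hb hab hF hφ0)
    (hmean ψ b a H hb ha hab.symm hH hψ0) hsymm
  rw [CoordSpace.ce_apply, CoordSpace.ce_apply, CoordSpace.ce_apply, ← add_div, ← mul_div_assoc,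
    abs_div, abs_of_pos hm, hsq φ a b F ha hb hab hF, hsq ψ b a H hb ha hab.symm hH,
    sum_congr rfl fun y hy => by rw [Pi.mul_apply, hF y hy, hH y hy], hFH, abs_mul,
    abs_of_pos hκ, ← mul_add, mul_left_comm]
  gcongr

end Expansion

end WSC

section Mobius

lemma abs_altSum_le {α : Type*} [DecidableEq α] {ℓ : Finset α → ℝ} {S : Finset α} {B : ℝ}
    (h : ∀ T ⊆ S, |ℓ T| ≤ B) : |altSum ℓ S| ≤ 2 ^ S.card * B := by
  rw [altSum]
  refine (abs_sum_le_sum_abs _ _).trans ?_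
  refine (sum_le_card_nsmul _ _ B fun T hT => ?_).trans (by simp)
  rw [abs_mul, abs_pow, abs_neg, abs_one, one_pow, one_mul]
  exact h T (mem_powerset.1 hT)

end Mobius

namespace WSC

section Pseudorandom

variable {n d : ℕ} {X : WSC n d} {k i : ℕ} {f : Cf n} {ε : ℝ}

lemma normInf_nonneg (X : WSC n d) (k : ℕ) (f : Cf n) : 0 ≤ normInf X k f :=
  Real.iSup_nonneg fun _ => abs_nonneg _

lemma abs_le_normInf (f : Cf n) {τ : Finset (Fin n)} (hτ : τ ∈ X.faces k) :
    |f τ| ≤ normInf X k f :=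
  le_ciSup (f := fun σ : {σ // σ ∈ X.faces k} => |f σ.1|) (Set.finite_range _).bddAbove ⟨τ, hτ⟩

lemma image_mem_faces (hk : k ≤ d) (A : Finset (Fin k)) (x : X.Ord k) :
    A.image x.1 ∈ X.faces A.card := by
  rw [← card_image_of_injective A x.injective]
  exact mem_faces_of_subset hk x.2 (image_subset_image (subset_univ A))

lemma abs_ce_onOrd_le (hk : k ≤ d) (hi : i ≤ k) (hf : Pseudorandom X k ε i f)
    {A : Finset (Fin k)} (hA : A.card ≤ i) (x : X.Ord k) :
    |(X.ordSpace k).ce A (onOrd f) x| ≤ min ε 1 * normInf X k f := by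
  obtain ⟨S, hAS, rfl⟩ := exists_superset_card_eq hA (by simpa using hi)
  rw [min_mul_of_nonneg _ _ (normInf_nonneg X k f), one_mul, ← CoordSpace.ce_ce_of_subset hAS]
  refine CoordSpace.abs_ce_le (fun y => le_min ?_ ?_) x
  · rw [ce_onOrd]
    exact (hf _ (image_mem_faces hk S y)).1
  · exact CoordSpace.abs_ce_le (fun z => abs_le_normInf f z.2) y

lemma ce_onOrd_mul_self_le (hk : k ≤ d) (hi : i ≤ k) (hf : Pseudorandom X k ε i f)
    {A : Finset (Fin k)} (hA : A.card ≤ i) (x : X.Ord k) :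
    (X.ordSpace k).ce A (onOrd f * onOrd f) x ≤ ε * normInf X k f ^ 2 := by
  obtain ⟨S, hAS, rfl⟩ := exists_superset_card_eq hA (by simpa using hi)
  rw [← CoordSpace.ce_ce_of_subset hAS]
  refine CoordSpace.ce_le (fun y => ?_) x
  have := (hf _ (image_mem_faces hk S y)).2
  rwa [linkIp_eq, ← ce_onOrd] at this

lemma nrm_ce_onOrd_le (hk : k ≤ d) (hi : i ≤ k) {A : Finset (Fin k)} (hA : A.card ≤ i) :
    (X.ordSpace k).nrm ((X.ordSpace k).ce A (onOrd f)) ≤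
      √(ip X i (Dc X k (k - i) f) (Dc X k (k - i) f)) := by
  obtain ⟨S, hAS, hS⟩ := exists_superset_card_eq hA (by simpa using hi)
  rw [← ex_ce_mul_ce hk f hS, ← CoordSpace.ce_ce_of_subset hAS]
  exact CoordSpace.nrm_ce_le _ _

lemma sq_min_mul_le (hε : 0 ≤ ε) (N : ℝ) : (min ε 1 * N) ^ 2 ≤ ε * N ^ 2 := by
  rw [mul_pow]
  refine mul_le_mul_of_nonneg_right ?_ (sq_nonneg N)
  have h1 := min_le_left ε 1
  have h2 := min_le_right ε 1
  have h3 : 0 ≤ min ε 1 := le_min hε zero_le_one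
  nlinarith

lemma regular_onOrd {γ : ℝ} (hγ : 0 ≤ γ) (hX : IsLSE X γ) (hk : k ≤ d) (hi : i ≤ k) (hi1 : 1 ≤ i)
    (hk2 : 2 ≤ k) (hε : 0 ≤ ε) (hf : Pseudorandom X k ε i f) :
    (X.ordSpace k).Regular (onOrd f) i γ (min ε 1 * normInf X k f) (ε * normInf X k f ^ 2)
      √(ip X i (Dc X k (k - i) f) (Dc X k (k - i) f)) ((k : ℝ) ^ i) := by
  have hk2' : (2 : ℝ) ≤ k := by exact_mod_cast hk2
  have hkE : (k : ℝ) ≤ (k : ℝ) ^ i := le_self_pow₀ (by linarith) (by omega)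
  exact
    { prod := isProd_ordSpace hγ hX hk
      γ0 := hγ
      B0 := mul_nonneg (le_min hε zero_le_one) (normInf_nonneg X k f)
      M0 := by positivity
      D0 := Real.sqrt_nonneg _
      bound := fun T hT => abs_ce_onOrd_le hk hi hf hT
      var := fun T hT => ce_onOrd_mul_self_le hk hi hf hT
      l2 := fun T hT => nrm_ce_onOrd_le hk hi hT
      two_pow := by gcongr
      two_le := hk2'.trans hkE
      card_sq := by
        rw [Fintype.card_fin]
        gcongr
      card_sets := by
        rw [card_powersetCard, card_univ, Fintype.card_fin]
        exact_mod_cast Nat.choose_le_pow k i }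

lemma ip_self_nonneg (i : ℕ) (g : Cf n) : 0 ≤ ip X i g g :=
  sum_nonneg fun τ _ => by
    rw [mul_assoc]
    exact mul_nonneg (X.w_nonneg i τ) (mul_self_nonneg _)

lemma EE_mono {φ ψ : Cf n} (h : ∀ τ ∈ X.faces k, φ τ ≤ ψ τ) : EE X k φ ≤ EE X k ψ :=
  sum_le_sum fun τ hτ => mul_le_mul_of_nonneg_left (h τ hτ) (X.w_nonneg k τ)

lemma EE_pow_four_le {F : Cf n} {c : ℝ} (h : ∀ τ ∈ X.faces k, F τ ^ 2 ≤ c) :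
    EE X k (fun τ => F τ ^ 4) ≤ c * EE X k (fun τ => F τ ^ 2) := by
  have : c * EE X k (fun τ => F τ ^ 2) = EE X k (fun τ => c * F τ ^ 2) := by
    rw [EE, EE, mul_sum]
    exact sum_congr rfl fun τ _ => by ring
  rw [this]
  refine EE_mono fun τ hτ => ?_
  nlinarith [h τ hτ, sq_nonneg (F τ)]

/-- At the extreme levels, where a face has only one sub-face, the level function is bounded. -/
lemma sq_fLevel_le (hk : k ≤ d) (hi : i ≤ k) (hik : i = 0 ∨ i = k) (hε : 0 ≤ ε)
    (hf : Pseudorandom X k ε i f) {τ : Finset (Fin n)} (hτ : τ ∈ X.faces k) :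
    fLevel X k f i τ ^ 2 ≤ 512 ^ i * ε * normInf X k f ^ 2 := by
  obtain ⟨x, rfl⟩ := exists_ord hτ
  have hS : ∃ S : Finset (Fin k), powersetCard i (univ.image x.1) = {S.image x.1} ∧ S.card = i := by
    rcases hik with rfl | rfl
    · exact ⟨∅, by simp, rfl⟩
    · refine ⟨univ, ?_, by simp⟩
      have h := powersetCard_self (univ.image x.1)
      rwa [X.card_mem i _ hτ] at h
  obtain ⟨S, hS, hSi⟩ := hS
  have habs : |fLevel X k f i (univ.image x.1)| ≤ 2 ^ i * (min ε 1 * normInf X k f) := by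
    rw [fLevel_eq_sum hk f hi hτ, hS, sum_singleton, ← hSi, ← card_image_of_injective S x.injective]
    refine abs_altSum_le fun T hT => ?_
    obtain ⟨A, hA, rfl⟩ := subset_image_iff.1 hT
    rw [← ce_onOrd]
    exact abs_ce_onOrd_le hk hi hf ((card_le_card hA).trans hSi.le) x
  calc fLevel X k f i (univ.image x.1) ^ 2
      ≤ (2 ^ i * (min ε 1 * normInf X k f)) ^ 2 := sq_le_sq.2 (habs.trans (le_abs_self _))
    _ = 4 ^ i * (min ε 1 * normInf X k f) ^ 2 := by
        rw [mul_pow, ← pow_mul, mul_comm i, pow_mul]; norm_num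
    _ ≤ 512 ^ i * (ε * normInf X k f ^ 2) := by
        gcongr
        · norm_num
        · exact sq_min_mul_le hε _
    _ = 512 ^ i * ε * normInf X k f ^ 2 := by ring

lemma EE_fLevel_pow_four_le {γ : ℝ} (hγ : 0 ≤ γ) (hX : IsLSE X γ) (hk : k ≤ d) (hi : i ≤ k)
    (hi1 : 1 ≤ i) (hk2 : 2 ≤ k) (hε : 0 ≤ ε) (hf : Pseudorandom X k ε i f) :
    EE X k (fun τ => fLevel X k f i τ ^ 4) ≤
      512 ^ i * (ε * normInf X k f ^ 2) * EE X k (fun τ => fLevel X k f i τ ^ 2) +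
      ((k : ℝ) ^ i) ^ 26 * (γ * (ε * normInf X k f ^ 2) *
        ip X i (Dc X k (k - i) f) (Dc X k (k - i) f)) := by
  have h := (regular_onOrd hγ hX hk hi hi1 hk2 hε hf).ex_level_pow_four_le (sq_min_mul_le hε _)
  rw [level_onOrd hk f hi, Real.sq_sqrt (ip_self_nonneg _ _)] at h
  have h2 : (onOrd (fLevel X k f i) : X.Ord k → ℝ) * onOrd (fLevel X k f i) =
      onOrd fun τ => fLevel X k f i τ ^ 2 := by
    ext x
    simp only [onOrd, Pi.mul_apply]
    ring
  have h4 : (onOrd (fun τ => fLevel X k f i τ ^ 2) : X.Ord k → ℝ) *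
      onOrd (fun τ => fLevel X k f i τ ^ 2) = onOrd fun τ => fLevel X k f i τ ^ 4 := by
    ext x
    simp only [onOrd, Pi.mul_apply]
    ring
  rwa [h2, h4, ex_onOrd, ex_onOrd] at h

end Pseudorandom

end WSC

/-- hypercontractivity on HDX: there exist universal constants
`C₁, C₂, C₃ > 0` such that on any two-sided `γ`-local-spectral expander with
`γ ≤ k^{−C₁i}`, any `(ε,i)`-pseudorandom `f ∈ C_k` satisfies
`E[(f_i^↑)⁴] ≤ C₂^i·ε·E[(f_i^↑)²]·‖f‖_∞² + k^{C₃i}·ε·γ^{1/2}·‖D_i^k f‖₂²·‖f‖_∞²`. -/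
theorem stmt13 : ∃ C₁ C₂ C₃ : ℝ, 0 < C₁ ∧ 0 < C₂ ∧ 0 < C₃ ∧
    ∀ (n d : ℕ) (X : WSC n d) (γ : ℝ), 0 ≤ γ → IsLSE X γ →
    ∀ (k : ℕ), k ≤ d → ∀ (i : ℕ), i ≤ k → γ ≤ (k:ℝ) ^ (-(C₁ * (i:ℝ))) →
    ∀ (f : Cf n) (ε : ℝ), 0 ≤ ε → Pseudorandom X k ε i f →
    EE X k (fun τ => (fLevel X k f i τ)^4) ≤
      C₂^i * ε * EE X k (fun τ => (fLevel X k f i τ)^2) * (normInf X k f)^2 +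
      (k:ℝ) ^ (C₃ * (i:ℝ)) * ε * Real.sqrt γ *
        ip X i (Dc X k (k-i) f) (Dc X k (k-i) f) * (normInf X k f)^2 := by
  refine ⟨1, 512, 26, by norm_num, by norm_num, by norm_num, ?_⟩
  intro n d X γ hγ hX k hk i hi hγk f ε hε hf
  have hip := WSC.ip_self_nonneg (X := X) i (Dc X k (k - i) f)
  by_cases hik : i = 0 ∨ i = k
  · have h := WSC.EE_pow_four_le fun τ hτ => WSC.sq_fLevel_le hk hi hik hε hf hτ
    refine le_add_of_le_of_nonneg (h.trans (le_of_eq (by ring))) ?_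
    positivity
  · have hi1 : 1 ≤ i := by omega
    have hk2 : 2 ≤ k := by omega
    have hk1 : (1 : ℝ) ≤ k := by exact_mod_cast (by omega : 1 ≤ k)
    have hγ1 : γ ≤ 1 := hγk.trans
      (Real.rpow_le_one_of_one_le_of_nonpos hk1 (by rw [one_mul]; simp))
    have hsqrt : γ ≤ √γ := Real.le_sqrt_of_sq_le (by nlinarith)
    have hpow : (k : ℝ) ^ ((26 : ℝ) * i) = ((k : ℝ) ^ i) ^ 26 := by
      rw [← pow_mul, ← Real.rpow_natCast]
      push_cast
      rw [mul_comm]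
    refine (WSC.EE_fLevel_pow_four_le hγ hX hk hi hi1 hk2 hε hf).trans ?_
    rw [hpow]
    have : γ * (ε * normInf X k f ^ 2 * ip X i (Dc X k (k - i) f) (Dc X k (k - i) f)) ≤
        √γ * (ε * normInf X k f ^ 2 * ip X i (Dc X k (k - i) f) (Dc X k (k - i) f)) :=
      mul_le_mul_of_nonneg_right hsqrt (by positivity)
    have := mul_le_mul_of_nonneg_left this (by positivity : (0 : ℝ) ≤ ((k : ℝ) ^ i) ^ 26)
    linarith
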